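/- Let u_ε be a sequence of topological solutions of (E_ε), i.e. u_ε → 0 uniformly on every compact subset of Ω∖Z as ε → 0. Then: (i) for every compact K ⊂ Ω∖Z and all integers m, n ≥ 1 there exists a constant C = C(K, m, n) > 0 such that sup_K Σ_{|α| ≤ m} |D^α u_ε| ≤ C ε^n for small ε; (ii) the measures ε^{-2} (1−e^{u_ε})²/(τ+e^{u_ε})² dx converge weakly in the sense of measures on Ω to 4(τ+1)π Σ_{i=1,2} Σ_{j=1}^{d_i} m_{j,i}² δ_{p_{j,i}}. -/

import Mathlib

open MeasureTheory Real Filter Set Metric Topology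

noncomputable section

/-- The Euclidean plane `ℝ²`. -/
abbrev Pl := EuclideanSpace ℝ (Fin 2)

/-- The unit lattice `ℤ² ⊆ ℝ²`; the flat 2-torus `Ω` is its quotient, which we model by
working with doubly periodic functions on the plane. -/
def unitLattice : Set Pl :=
  {v | ∃ a b : ℤ, v = (a : ℝ) • EuclideanSpace.single 0 (1:ℝ) +
      (b : ℝ) • EuclideanSpace.single 1 (1:ℝ)}

/-- A fundamental domain for the torus `Ω` (of total area `|Ω| = 1`). -/
def fund : Set Pl := {x | x 0 ∈ Ico (0:ℝ) 1 ∧ x 1 ∈ Ico (0:ℝ) 1}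

/-- A doubly periodic function on the plane, i.e. a function on the torus `Ω`. -/
def Periodic2 (u : Pl → ℝ) : Prop := ∀ x : Pl, ∀ v ∈ unitLattice, u (x + v) = u x

/-- Partial derivative in the `i`-th coordinate direction. -/
def pd (u : Pl → ℝ) (i : Fin 2) : Pl → ℝ :=
  fun x => lineDeriv ℝ u x (EuclideanSpace.single i (1:ℝ))

/-- The Laplacian `Δu`. -/
def lap (u : Pl → ℝ) (x : Pl) : ℝ := pd (pd u 0) 0 x + pd (pd u 1) 1 x

/-- `|∇u|²`. -/
def gradSq (u : Pl → ℝ) (x : Pl) : ℝ := (pd u 0 x) ^ 2 + (pd u 1 x) ^ 2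

/-- The nonlinearity `f_τ(t) = e^t (1 − e^t) / (τ + e^t)³`. -/
def fτ (τ t : ℝ) : ℝ := exp t * (1 - exp t) / (τ + exp t) ^ 3

/-- `f_τ'(t) = e^t (τ − 2(τ+1) e^t + e^{2t}) / (τ + e^t)⁴`. -/
def fτ' (τ t : ℝ) : ℝ := exp t * (τ - 2 * (τ + 1) * exp t + exp (2 * t)) / (τ + exp t) ^ 4

/-- The antiderivative `F_{2,τ}(t) = e^t ((1−τ) e^t + 2τ) / (2τ² (τ+e^t)²)` of `f_τ`. -/
def F2τ (τ t : ℝ) : ℝ := exp t * ((1 - τ) * exp t + 2 * τ) / (2 * τ ^ 2 * (τ + exp t) ^ 2)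

/-- `u − 2a ln‖· − p‖` extends smoothly across `p`: this encodes the distributional
equation `Δu = 4πa δ_p + (smooth)` near `p`. -/
def LogSing (u : Pl → ℝ) (p : Pl) (a : ℝ) : Prop :=
  ∃ r > 0, ∃ v : Pl → ℝ, ContDiffOn ℝ (⊤ : ℕ∞) v (ball p r) ∧
    ∀ x ∈ ball p r, x ≠ p → u x = 2 * a * Real.log ‖x - p‖ + v x

/-- The vortex data: distinct points `p_{j,1}` (`1 ≤ j ≤ d₁`), `p_{j,2}` (`1 ≤ j ≤ d₂`)
of the torus with multiplicities `m_{j,1} ≥ 0`, `m_{j,2} ≥ 0`. -/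
structure VortexData where
  d₁ : ℕ
  d₂ : ℕ
  p₁ : Fin d₁ → Pl
  p₂ : Fin d₂ → Pl
  m₁ : Fin d₁ → ℝ
  m₂ : Fin d₂ → ℝ
  m₁_nonneg : ∀ j, 0 ≤ m₁ j
  m₂_nonneg : ∀ j, 0 ≤ m₂ j
  distinct : ∀ i j : Fin d₁ ⊕ Fin d₂, i ≠ j → ∀ v ∈ unitLattice,
      Sum.elim p₁ p₂ i ≠ Sum.elim p₁ p₂ j + v

namespace VortexData
variable (V : VortexData)

/-- The set `Z₁` of vortex points `p_{j,1}` (viewed in the plane: all lattice translates). -/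
def Z1 : Set Pl := {x | ∃ j v, v ∈ unitLattice ∧ x = V.p₁ j + v}

/-- The set `Z₂` of vortex points `p_{j,2}` (viewed in the plane: all lattice translates). -/
def Z2 : Set Pl := {x | ∃ j v, v ∈ unitLattice ∧ x = V.p₂ j + v}

/-- The full vortex set `Z = Z₁ ∪ Z₂`. -/
def Z : Set Pl := V.Z1 ∪ V.Z2

/-- `N₁ = Σ_j m_{j,1}`. -/
def N1 : ℝ := ∑ j, V.m₁ j

/-- `N₂ = Σ_j m_{j,2}`. -/
def N2 : ℝ := ∑ j, V.m₂ j

end VortexData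

/-- `u` is a solution of `(E_ε)`:
`Δu + ε⁻² f_τ(u) = 4π Σ_j m_{j,1} δ_{p_{j,1}} − 4π Σ_j m_{j,2} δ_{p_{j,2}}` on `Ω`,
formulated classically: `u` is doubly periodic, smooth away from `Z`, solves the PDE
classically off `Z`, and has the prescribed logarithmic singularities at the vortices. -/
structure IsSolution (V : VortexData) (τ ε : ℝ) (u : Pl → ℝ) : Prop where
  periodic : Periodic2 u
  smooth : ContDiffOn ℝ (⊤ : ℕ∞) u (V.Z)ᶜ
  pde : ∀ x ∉ V.Z, lap u x + (ε ^ 2)⁻¹ * fτ τ (u x) = 0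
  sing₁ : ∀ j, LogSing u (V.p₁ j) (V.m₁ j)
  sing₂ : ∀ j, LogSing u (V.p₂ j) (-(V.m₂ j))

/-- The quadratic form `∫_Ω |∇φ|² − ε⁻² f_τ'(u) φ²` of the linearized operator at `u`. -/
def QuadForm (τ ε : ℝ) (u φ : Pl → ℝ) : ℝ :=
  ∫ x in fund, (gradSq φ x - (ε ^ 2)⁻¹ * fτ' τ (u x) * (φ x) ^ 2)

/-- `u` is a stable solution: the first eigenvalue `μ_ε` of the linearized operator is
nonnegative, i.e. the quadratic form is nonnegative on all (smooth, doubly periodic)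
test functions. -/
def Stable (τ ε : ℝ) (u : Pl → ℝ) : Prop :=
  ∀ φ : Pl → ℝ, ContDiff ℝ (⊤ : ℕ∞) φ → Periodic2 φ → 0 ≤ QuadForm τ ε u φ

/-- `u` is strictly stable: the first eigenvalue `μ_ε` of the linearized operator is
strictly positive. -/
def StrictlyStable (τ ε : ℝ) (u : Pl → ℝ) : Prop :=
  ∃ μ > 0, ∀ φ : Pl → ℝ, ContDiff ℝ (⊤ : ℕ∞) φ → Periodic2 φ →
    μ * (∫ x in fund, (φ x) ^ 2) ≤ QuadForm τ ε u φ


/-! ### Partial derivatives and the maximum principle -/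

/-- The `i`-th standard basis vector. -/
abbrev bv (i : Fin 2) : Pl := EuclideanSpace.single i (1:ℝ)

lemma bv_self (i : Fin 2) : bv i i = 1 := by simp [bv]

lemma bv_ne {i j : Fin 2} (h : j ≠ i) : bv i j = 0 := by simp [bv, h]

lemma pd_line (f : Pl → ℝ) (i : Fin 2) (x : Pl) (t : ℝ) :
    pd f i (x + t • bv i) = deriv (fun s => f (x + s • bv i)) t := by
  unfold pd lineDeriv
  have : (fun s : ℝ => f (x + t • bv i + s • bv i)) = fun s => (fun r => f (x + r • bv i)) (t + s) := by
    funext s; simp only [add_smul, add_assoc]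
  show deriv (fun s : ℝ => f (x + t • bv i + s • bv i)) 0 = _
  rw [this]
  have := deriv_comp_const_add (f := fun r : ℝ => f (x + r • bv i)) t 0
  rw [add_zero] at this
  exact this

lemma pd_pd (f : Pl → ℝ) (i : Fin 2) (x : Pl) :
    pd (pd f i) i x = deriv (deriv (fun s : ℝ => f (x + s • bv i))) 0 := by
  have h := pd_line (pd f i) i x 0
  rw [zero_smul, add_zero] at h
  rw [h]; congr 1; funext s; exact pd_line f i x s

lemma continuousAt_line {f : Pl → ℝ} {x : Pl} (hf : ContinuousAt f x) (v : Pl) :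
    ContinuousAt (fun s : ℝ => f (x + s • v)) 0 := by
  apply ContinuousAt.comp (g := f) (f := fun s : ℝ => x + s • v)
  · simpa using hf
  · fun_prop

lemma pd_pd_nonpos {f : Pl → ℝ} {x : Pl} (hm : IsLocalMax f x) (hc : ContinuousAt f x) (i : Fin 2) :
    pd (pd f i) i x ≤ 0 := by
  rw [pd_pd]
  set g : ℝ → ℝ := fun s => f (x + s • bv i) with hg
  have hgc : ContinuousAt g 0 := continuousAt_line hc _
  have hgm : IsLocalMax g 0 := by
    have ht : Tendsto (fun s : ℝ => x + s • bv i) (𝓝 0) (𝓝 x) := by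
      have : ContinuousAt (fun s : ℝ => x + s • bv i) 0 := by fun_prop
      simpa [ContinuousAt] using this
    have := ht.eventually hm
    unfold IsLocalMax IsMaxFilter
    filter_upwards [this] with s hs
    simpa [hg] using hs
  by_contra hpos
  push Not at hpos
  have hmin : IsLocalMin g 0 := isLocalMin_of_deriv_deriv_pos hpos hgm.deriv_eq_zero hgc
  have hconst : g =ᶠ[𝓝 0] fun _ => g 0 := by
    filter_upwards [hmin, hgm] with s h1 h2
    exact le_antisymm h2 h1
  have h0 : deriv (deriv g) 0 = 0 := by
    rw [hconst.deriv.deriv_eq]; simp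
  exact absurd h0 hpos.ne'

lemma lap_nonpos {f : Pl → ℝ} {x : Pl} (hm : IsLocalMax f x) (hc : ContinuousAt f x) :
    lap f x ≤ 0 := by
  have h0 := pd_pd_nonpos hm hc 0
  have h1 := pd_pd_nonpos hm hc 1
  unfold lap; linarith

lemma max_principle {f : Pl → ℝ} {D O : Set Pl} (hD : IsCompact D) (hO : IsOpen O) (hOD : O ⊆ D)
    (hf : ContinuousOn f D) (hb : ∀ x ∈ D, x ∉ O → f x ≤ 0)
    (hi : ∀ x ∈ O, 0 < f x → 0 < lap f x) : ∀ x ∈ D, f x ≤ 0 := by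
  intro x hx
  obtain ⟨y, hy, hmax⟩ := hD.exists_isMaxOn ⟨x, hx⟩ hf
  by_contra hpos
  push Not at hpos
  have hfy : 0 < f y := lt_of_lt_of_le hpos (hmax hx)
  have hyO : y ∈ O := by
    by_contra h
    exact absurd (hb y hy h) (not_le.2 hfy)
  have hn : D ∈ 𝓝 y := mem_of_superset (hO.mem_nhds hyO) hOD
  have := lap_nonpos (hmax.isLocalMax hn) (hf.continuousAt hn)
  exact absurd (hi y hyO hfy) (not_lt.2 this)

lemma lap_eq_ij (f : Pl → ℝ) (x : Pl) {i j : Fin 2} (h : j ≠ i) :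
    lap f x = pd (pd f i) i x + pd (pd f j) j x := by
  unfold lap
  fin_cases i <;> fin_cases j <;> simp_all [add_comm]

/-- smoothness along lines gives additivity of second derivatives -/
lemma pd_pd_sub {f g : Pl → ℝ} {x : Pl} (hf : ContDiffAt ℝ 2 f x) (hg : ContDiffAt ℝ 2 g x)
    (i : Fin 2) : pd (pd (fun y => f y - g y) i) i x = pd (pd f i) i x - pd (pd g i) i x := by
  simp only [pd_pd]
  have key : ∀ h : Pl → ℝ, ContDiffAt ℝ 2 h x → ContDiffAt ℝ 2 (fun s : ℝ => h (x + s • bv i)) 0 := by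
    intro h hh
    apply ContDiffAt.comp (g := h) (f := fun s : ℝ => x + s • bv i)
    · simpa using hh
    · fun_prop
  have h1 := key f hf
  have h2 := key g hg
  have e1 : ∀ᶠ s in 𝓝 (0:ℝ), deriv (fun s : ℝ => f (x + s • bv i) - g (x + s • bv i)) s =
      deriv (fun s : ℝ => f (x + s • bv i)) s - deriv (fun s : ℝ => g (x + s • bv i)) s := by
    filter_upwards [h1.eventually (by simp), h2.eventually (by simp)] with s a b
    exact deriv_fun_sub (a.differentiableAt (by norm_num)) (b.differentiableAt (by norm_num))
  rw [EventuallyEq.deriv_eq e1]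
  have d : ∀ h : ℝ → ℝ, ContDiffAt ℝ 2 h 0 → DifferentiableAt ℝ (deriv h) 0 := by
    intro h hh
    have h3 : ContDiffAt ℝ 1 (deriv h) 0 := by
      have := hh.fderiv_right (m := 1) (by norm_num)
      have h4 : deriv h = fun s => fderiv ℝ h s 1 := by funext s; simp
      rw [h4]
      exact this.clm_apply contDiffAt_const
    exact h3.differentiableAt (by norm_num)
  exact deriv_fun_sub (d _ h1) (d _ h2)

lemma lap_sub {f g : Pl → ℝ} {x : Pl} (hf : ContDiffAt ℝ 2 f x) (hg : ContDiffAt ℝ 2 g x) :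
    lap (fun y => f y - g y) x = lap f x - lap g x := by
  unfold lap; rw [pd_pd_sub hf hg, pd_pd_sub hf hg]; ring

lemma deriv2_quad (a b c : ℝ) : deriv (deriv (fun s : ℝ => a + b * s + c * s ^ 2)) 0 = 2 * c := by
  have : deriv (fun s : ℝ => a + b * s + c * s ^ 2) = fun s => b + 2 * c * s := by
    funext s
    have h : HasDerivAt (fun s : ℝ => a + b * s + c * s ^ 2) (0 + b * 1 + c * (2 * s)) s := by
      apply HasDerivAt.add
      · exact (hasDerivAt_const s a).add ((hasDerivAt_id s).const_mul b)
      · simpa using ((hasDerivAt_pow 2 s).const_mul c)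
    rw [h.deriv]; ring
  rw [this]
  have h : HasDerivAt (fun s : ℝ => b + 2 * c * s) (0 + 2 * c * 1) 0 :=
    (hasDerivAt_const (0:ℝ) b).add ((hasDerivAt_id (0:ℝ)).const_mul (2 * c))
  rw [h.deriv]; ring

/-- second derivative of a quadratic in the coordinates -/
lemma pd_pd_quad (f : Pl → ℝ) (i : Fin 2) (x : Pl) (a b c : ℝ)
    (h : ∀ s : ℝ, f (x + s • bv i) = a + b * s + c * s ^ 2) : pd (pd f i) i x = 2 * c := by
  rw [pd_pd]
  have : (fun s : ℝ => f (x + s • bv i)) = fun s => a + b * s + c * s ^ 2 := funext h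
  rw [this, deriv2_quad]

lemma normsq_eq (x : Pl) : ‖x‖ ^ 2 = x 0 ^ 2 + x 1 ^ 2 := by
  rw [EuclideanSpace.norm_sq_eq]; simp

lemma decay_estimate {g : Pl → ℝ} {x0 : Pl} {R A M : ℝ} (hR : 0 < R) (hA : 0 < A) (hM : 0 ≤ M)
    (hg : ∀ x ∈ closedBall x0 R, ContDiffAt ℝ 2 g x) (hgM : ∀ x ∈ closedBall x0 R, g x ≤ M)
    (hlap : ∀ x ∈ closedBall x0 R, 0 < g x → A * g x ≤ lap g x) : g x0 ≤ 4 * M / (R ^ 2 * A) := by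
  set δ := 4 * M / (R ^ 2 * A) with hδ
  have hδ0 : 0 ≤ δ := by positivity
  set ψ : Pl → ℝ := fun x => M / R ^ 2 * ((x 0 - x0 0) ^ 2 + (x 1 - x0 1) ^ 2) + δ with hψ
  have hψs : ContDiff ℝ 2 ψ := by
    simp only [hψ]; fun_prop
  have hψn : ∀ x, ψ x = M / R ^ 2 * (dist x x0) ^ 2 + δ := by
    intro x; rw [dist_eq_norm, normsq_eq]; simp [hψ]
  have hψl : ∀ x, lap ψ x = 4 * M / R ^ 2 := by
    intro x
    have e0 : pd (pd ψ 0) 0 x = 2 * (M / R ^ 2) :=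
      pd_pd_quad ψ 0 x (ψ x) (2 * (M / R ^ 2) * (x 0 - x0 0)) _ (by
        intro s; simp [hψ]; ring)
    have e1 : pd (pd ψ 1) 1 x = 2 * (M / R ^ 2) :=
      pd_pd_quad ψ 1 x (ψ x) (2 * (M / R ^ 2) * (x 1 - x0 1)) _ (by
        intro s; simp [hψ]; ring)
    unfold lap; rw [e0, e1]; ring
  have key := max_principle (f := fun x => g x - ψ x) (D := closedBall x0 R) (O := ball x0 R)
    (isCompact_closedBall _ _) isOpen_ball ball_subset_closedBall
    (fun x hx => (((hg x hx).continuousAt).sub hψs.continuous.continuousAt).continuousWithinAt)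
    (by
      intro x hx hx'
      have hd : dist x x0 = R := le_antisymm hx (by simpa using hx')
      rw [hψn, hd]
      have := hgM x hx
      have : M / R ^ 2 * R ^ 2 = M := by field_simp
      linarith)
    (by
      intro x hx hpos
      have hx' := ball_subset_closedBall hx
      rw [lap_sub (hg x hx') hψs.contDiffAt, hψl]
      have hgx : δ < g x := by
        have : δ ≤ ψ x := by rw [hψn]; have : 0 ≤ M / R ^ 2 * (dist x x0) ^ 2 := by positivity
                             linarith
        linarith
      have h1 := hlap x hx' (by linarith)
      have h2 : A * δ < A * g x := by nlinarith
      have h3 : A * δ = 4 * M / R ^ 2 := by rw [hδ]; field_simp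
      linarith)
  have := key x0 (mem_closedBall_self hR.le)
  simp only [hψn, dist_self] at this
  linarith

/-- reflection in the `i`-th coordinate about `x0` -/
def rfl' (i : Fin 2) (x0 x : Pl) : Pl := x - (2 * (x i - x0 i)) • bv i

lemma rfl'_line_i (i : Fin 2) (x0 x : Pl) (s : ℝ) :
    rfl' i x0 (x + s • bv i) = rfl' i x0 x + (-s) • bv i := by
  unfold rfl'
  have : (x + s • bv i) i = x i + s := by simp
  rw [this]; module

lemma rfl'_line_j {i j : Fin 2} (h : j ≠ i) (x0 x : Pl) (s : ℝ) :
    rfl' i x0 (x + s • bv j) = rfl' i x0 x + s • bv j := by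
  unfold rfl'
  have : (x + s • bv j) i = x i := by simp [h.symm]
  rw [this]; module

lemma lap_rfl' (i : Fin 2) (x0 : Pl) (g : Pl → ℝ) (x : Pl) :
    lap (fun y => g (rfl' i x0 y)) x = lap g (rfl' i x0 x) := by
  obtain ⟨j, hj⟩ : ∃ j : Fin 2, j ≠ i := exists_ne i
  rw [lap_eq_ij _ _ hj, lap_eq_ij _ _ hj]
  simp only [pd_pd, rfl'_line_i, rfl'_line_j hj]
  congr 1
  set h : ℝ → ℝ := fun s => g (rfl' i x0 x + s • bv i) with hh
  have e : (fun s : ℝ => g (rfl' i x0 x + (-s) • bv i)) = fun s => h (-s) := rfl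
  rw [e]
  have e1 : deriv (fun s => h (-s)) = fun s => - deriv h (-s) := by
    funext s; exact deriv_comp_neg h s
  rw [e1]
  have : deriv (fun s => - deriv h (-s)) 0 = - deriv (fun s => deriv h (-s)) 0 := deriv.fun_neg
  rw [this, deriv_comp_neg]; simp

lemma pl_dist_le {x x0 : Pl} {i j : Fin 2} (h : j ≠ i) {d : ℝ} (hd : 0 ≤ d)
    (h1 : |x i - x0 i| ≤ d) (h2 : |x j - x0 j| ≤ d) : x ∈ closedBall x0 (2 * d) := by
  rw [mem_closedBall, dist_eq_norm]
  apply le_of_sq_le_sq _ (by positivity) |> fun h => h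
  rw [normsq_eq]
  have a := sq_le_sq' (abs_le.1 h1).1 (abs_le.1 h1).2
  have b := sq_le_sq' (abs_le.1 h2).1 (abs_le.1 h2).2
  have : (x - x0) 0 ^ 2 + (x - x0) 1 ^ 2 = (x i - x0 i) ^ 2 + (x j - x0 j) ^ 2 := by
    fin_cases i <;> fin_cases j <;> simp_all [add_comm]
  rw [this]; nlinarith [sq_nonneg d]

lemma continuous_rfl' (i : Fin 2) (x0 : Pl) : ContDiff ℝ 2 (rfl' i x0) := by
  unfold rfl'; fun_prop

lemma gradient_upper {g : Pl → ℝ} {x0 : Pl} {d M B : ℝ} (i : Fin 2) (hd : 0 < d) (hM : 0 ≤ M)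
    (hB : 0 < B) (hg : ∀ x ∈ closedBall x0 (2 * d), ContDiffAt ℝ 2 g x)
    (hgM : ∀ x ∈ closedBall x0 (2 * d), |g x| ≤ M)
    (hlap : ∀ x ∈ closedBall x0 (2 * d), |lap g x| ≤ B) : pd g i x0 ≤ 2 * M / d + B * d := by
  obtain ⟨j, hj⟩ : ∃ j : Fin 2, j ≠ i := exists_ne i
  set D : Set Pl := {x | (0 ≤ x i - x0 i ∧ x i - x0 i ≤ d) ∧ |x j - x0 j| ≤ d} with hDdef
  set O : Set Pl := {x | (0 < x i - x0 i ∧ x i - x0 i < d) ∧ |x j - x0 j| < d} with hOdef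
  have hDb : ∀ x ∈ D, x ∈ closedBall x0 (2 * d) := by
    intro x hx
    exact pl_dist_le hj hd.le (abs_le.2 ⟨by linarith [hx.1.1], hx.1.2⟩) hx.2
  have hDr : ∀ x ∈ D, rfl' i x0 x ∈ closedBall x0 (2 * d) := by
    intro x hx
    have e1 : rfl' i x0 x i = 2 * x0 i - x i := by simp [rfl']; ring
    have e2 : rfl' i x0 x j = x j := by simp [rfl', hj]
    refine pl_dist_le hj hd.le ?_ ?_
    · rw [e1, abs_le]; constructor <;> linarith [hx.1.1, hx.1.2]
    · rw [e2]; exact hx.2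
  have ca : Continuous (fun x : Pl => x i - x0 i) := by fun_prop
  have cb : Continuous (fun x : Pl => |x j - x0 j|) := by fun_prop
  have hDc : IsCompact D := by
    apply (isCompact_closedBall x0 (2 * d)).of_isClosed_subset _ hDb
    exact ((isClosed_le continuous_const ca).inter (isClosed_le ca continuous_const)).inter
      (isClosed_le cb continuous_const)
  have hOo : IsOpen O := by
    exact ((isOpen_lt continuous_const ca).inter (isOpen_lt ca continuous_const)).inter
      (isOpen_lt cb continuous_const)
  have hOD : O ⊆ D := fun x hx => ⟨⟨hx.1.1.le, hx.1.2.le⟩, hx.2.le⟩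
  set ψ : Pl → ℝ := fun x => 2 * (M / d ^ 2 * ((x j - x0 j) ^ 2 + (x i - x0 i) * (2 * d - (x i - x0 i)))
    + B * ((x i - x0 i) * (d - (x i - x0 i)))) with hψ
  have hψs : ContDiff ℝ 2 ψ := by
    simp only [hψ]; fun_prop
  have hψl : ∀ x, lap ψ x = - 4 * B := by
    intro x
    have e0 : pd (pd ψ i) i x = 2 * (- 2 * (M / d ^ 2) - 2 * B) :=
      pd_pd_quad ψ i x (ψ x) (4 * (M / d ^ 2) * (d - (x i - x0 i)) + 2 * B * (d - 2 * (x i - x0 i))) _ (by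
        intro s; simp [hψ, hj]; ring)
    have e1 : pd (pd ψ j) j x = 2 * (2 * (M / d ^ 2)) :=
      pd_pd_quad ψ j x (ψ x) (4 * (M / d ^ 2) * (x j - x0 j)) _ (by
        intro s; simp [hψ, hj.symm]; ring)
    rw [lap_eq_ij _ _ hj, e0, e1]; ring
  have hgr : ∀ x ∈ D, ContDiffAt ℝ 2 (fun y => g (rfl' i x0 y)) x := fun x hx =>
    ContDiffAt.comp (g := g) x (hg _ (hDr x hx)) (continuous_rfl' i x0).contDiffAt
  have hφ : ∀ x ∈ D, ContDiffAt ℝ 2 (fun y => g y - g (rfl' i x0 y)) x := fun x hx =>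
    (hg x (hDb x hx)).sub (hgr x hx)
  have hMd : M / d ^ 2 * d ^ 2 = M := by field_simp
  have hMd0 : 0 ≤ M / d ^ 2 := by positivity
  have key := max_principle (f := fun x => (g x - g (rfl' i x0 x)) - ψ x) hDc hOo hOD
    (fun x hx => ((hφ x hx).continuousAt.sub hψs.continuous.continuousAt).continuousWithinAt)
    (by
      intro x hx hxO
      have b1 := abs_le.1 (hgM _ (hDb x hx))
      have b2 := abs_le.1 (hgM _ (hDr x hx))
      obtain ⟨⟨h1, h2⟩, h3⟩ := hx
      simp only [hψ]
      set a := x i - x0 i with ha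
      set b := x j - x0 j with hb
      have q1 : 0 ≤ B * (a * (d - a)) := by
        apply mul_nonneg hB.le; apply mul_nonneg h1; linarith
      have q2 : 0 ≤ a * (2 * d - a) := mul_nonneg h1 (by linarith)
      rcases h1.eq_or_lt with h0 | h0
      · have : rfl' i x0 x = x := by simp [rfl', ← ha, ← h0]
        rw [this]
        have : 0 ≤ M / d ^ 2 * (b ^ 2 + a * (2 * d - a)) := by positivity
        linarith
      · have : d ^ 2 ≤ b ^ 2 + a * (2 * d - a) := by
          rcases h2.eq_or_lt with h4 | h4
          · rw [h4]; nlinarith [sq_nonneg b]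
          · have h5 : |b| = d := by
              apply le_antisymm h3
              by_contra hc
              push Not at hc
              exact hxO ⟨⟨h0, h4⟩, hc⟩
            rw [← sq_abs b, h5]; linarith
        have := mul_le_mul_of_nonneg_left this hMd0
        linarith)
    (by
      intro x hx _
      have hxD := hOD hx
      rw [lap_sub (hφ x hxD) hψs.contDiffAt, lap_sub (hg x (hDb x hxD)) (hgr x hxD), hψl, lap_rfl']
      have b1 := abs_le.1 (hlap _ (hDb x hxD))
      have b2 := abs_le.1 (hlap _ (hDr x hxD))
      linarith)
  -- conclude along the ray
  have hx0 : x0 ∈ closedBall x0 (2 * d) := mem_closedBall_self (by positivity)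
  have hld : HasLineDerivAt ℝ g (pd g i x0) x0 (bv i) :=
    (((hg x0 hx0).differentiableAt (by norm_num)).lineDifferentiableAt).hasLineDerivAt
  have hT := hld.tendsto_slope_zero_right
  have hT2 := hld.tendsto_slope_zero_left
  have hneg : Tendsto (fun t : ℝ => -t) (𝓝[>] 0) (𝓝[<] 0) := by
    have := tendsto_neg_nhdsGT (a := (0:ℝ))
    simpa using this
  have hT3 := hT.add (hT2.comp hneg)
  have hle : pd g i x0 + pd g i x0 ≤ 2 * (2 * M / d + B * d) := by
    refine le_of_tendsto hT3 ?_
    have : Ioo (0:ℝ) d ∈ 𝓝[>] (0:ℝ) := Ioo_mem_nhdsGT hd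
    filter_upwards [this] with t ht
    have hk := key (x0 + t • bv i) ⟨⟨by simp [ht.1.le], by simp [ht.2.le]⟩, by simp [hj, hd.le]⟩
    have hr : rfl' i x0 (x0 + t • bv i) = x0 + (-t) • bv i := by
      rw [rfl'_line_i]; simp [rfl']
    rw [hr] at hk
    have e1 : (x0 + t • bv i) i - x0 i = t := by simp
    have e2 : (x0 + t • bv i) j - x0 j = 0 := by simp [hj]
    simp only [hψ, e1, e2] at hk
    have ht0 := ht.1
    simp only [Function.comp, smul_eq_mul]
    have e3 : t⁻¹ * (g (x0 + t • bv i) - g x0) + (-t)⁻¹ * (g (x0 + (-t) • bv i) - g x0)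
      = (g (x0 + t • bv i) - g (x0 + (-t) • bv i)) / t := by field_simp; ring
    rw [e3, div_le_iff₀ ht0]
    have e4 : 2 * M / d = M / d ^ 2 * (2 * d) := by field_simp
    rw [e4]
    have q1 : M / d ^ 2 * (0 ^ 2 + t * (2 * d - t)) ≤ M / d ^ 2 * (2 * d) * t := by
      rw [mul_assoc]; apply mul_le_mul_of_nonneg_left _ hMd0; nlinarith
    have q2 : B * (t * (d - t)) ≤ B * d * t := by
      rw [mul_assoc]; apply mul_le_mul_of_nonneg_left _ hB.le; nlinarith
    linarith
  linarith

lemma pd_neg (g : Pl → ℝ) (i : Fin 2) : pd (fun y => - g y) i = fun y => - pd g i y := by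
  funext x; unfold pd lineDeriv; exact deriv.fun_neg

lemma lap_neg (g : Pl → ℝ) (x : Pl) : lap (fun y => - g y) x = - lap g x := by
  unfold lap; rw [pd_neg, pd_neg, pd_neg, pd_neg]; ring

lemma gradient_estimate {g : Pl → ℝ} {x0 : Pl} {d M B : ℝ} (i : Fin 2) (hd : 0 < d) (hM : 0 ≤ M)
    (hB : 0 < B) (hg : ∀ x ∈ closedBall x0 (2 * d), ContDiffAt ℝ 2 g x)
    (hgM : ∀ x ∈ closedBall x0 (2 * d), |g x| ≤ M)
    (hlap : ∀ x ∈ closedBall x0 (2 * d), |lap g x| ≤ B) : |pd g i x0| ≤ 2 * M / d + B * d := by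
  have h1 := gradient_upper i hd hM hB hg hgM hlap
  have h2 := gradient_upper (g := fun y => - g y) (x0 := x0) i hd hM hB (fun x hx => (hg x hx).neg)
    (fun x hx => by rw [abs_neg]; exact hgM x hx)
    (fun x hx => by rw [lap_neg, abs_neg]; exact hlap x hx)
  rw [pd_neg] at h2
  exact abs_le.2 ⟨by linarith, h1⟩


/-! ### Smoothness of partial derivatives -/

lemma two_le_inf : (2 : WithTop ℕ∞) ≤ ((⊤ : ℕ∞) : WithTop ℕ∞) := by
  exact WithTop.coe_le_coe.2 (le_top : (2 : ℕ∞) ≤ ⊤)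

/-- Smooth (`C^∞`) on a set. -/
abbrev SmoothOn (g : Pl → ℝ) (U : Set Pl) : Prop := ContDiffOn ℝ (⊤ : ℕ∞) g U

lemma SmoothOn.at {g : Pl → ℝ} {U : Set Pl} (hU : IsOpen U) (hg : SmoothOn g U) {x : Pl} (hx : x ∈ U) :
    ContDiffAt ℝ (⊤ : ℕ∞) g x := ContDiffOn.contDiffAt hg (hU.mem_nhds hx)

lemma SmoothOn.diffAt {g : Pl → ℝ} {U : Set Pl} (hU : IsOpen U) (hg : SmoothOn g U) {x : Pl}
    (hx : x ∈ U) : DifferentiableAt ℝ g x := (SmoothOn.at hU hg hx).differentiableAt (by simp)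

lemma pd_eq_fderiv {g : Pl → ℝ} {x : Pl} (hg : DifferentiableAt ℝ g x) (i : Fin 2) :
    pd g i x = fderiv ℝ g x (bv i) := hg.lineDeriv_eq_fderiv

lemma pd_congr {f g : Pl → ℝ} {U : Set Pl} (hU : IsOpen U) (h : ∀ x ∈ U, f x = g x) (i : Fin 2)
    {x : Pl} (hx : x ∈ U) : pd f i x = pd g i x := by
  have : f =ᶠ[𝓝 x] g := by filter_upwards [hU.mem_nhds hx] with y hy using h y hy
  exact this.lineDeriv_eq

lemma lap_congr {f g : Pl → ℝ} {U : Set Pl} (hU : IsOpen U) (h : ∀ x ∈ U, f x = g x)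
    {x : Pl} (hx : x ∈ U) : lap f x = lap g x := by
  unfold lap
  rw [pd_congr hU (fun y hy => pd_congr hU h 0 hy) 0 hx, pd_congr hU (fun y hy => pd_congr hU h 1 hy) 1 hx]

lemma SmoothOn.fderiv {g : Pl → ℝ} {U : Set Pl} (hU : IsOpen U) (hg : SmoothOn g U) :
    ContDiffOn ℝ (⊤ : ℕ∞) (fderiv ℝ g) U := ContDiffOn.fderiv_of_isOpen hg hU (by simp)

lemma SmoothOn.pd {g : Pl → ℝ} {U : Set Pl} (hU : IsOpen U) (hg : SmoothOn g U) (i : Fin 2) :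
    SmoothOn (pd g i) U := by
  have h : ContDiffOn ℝ (⊤ : ℕ∞) (fun x => _root_.fderiv ℝ g x (bv i)) U :=
    (SmoothOn.fderiv hU hg).clm_apply contDiffOn_const
  exact h.congr (fun x hx => pd_eq_fderiv (SmoothOn.diffAt hU hg hx) i)

lemma SmoothOn.lap {g : Pl → ℝ} {U : Set Pl} (hU : IsOpen U) (hg : SmoothOn g U) :
    SmoothOn (lap g) U :=
  ContDiffOn.add (SmoothOn.pd hU (SmoothOn.pd hU hg 0) 0) (SmoothOn.pd hU (SmoothOn.pd hU hg 1) 1)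

lemma pd_comm {g : Pl → ℝ} {U : Set Pl} (hU : IsOpen U) (hg : SmoothOn g U) (i j : Fin 2)
    {x : Pl} (hx : x ∈ U) : pd (pd g i) j x = pd (pd g j) i x := by
  have key : ∀ i j : Fin 2, pd (pd g i) j x = fderiv ℝ (fderiv ℝ g) x (bv j) (bv i) := by
    intro i j
    rw [pd_congr hU (fun y hy => pd_eq_fderiv (SmoothOn.diffAt hU hg hy) i) j hx]
    have hd : DifferentiableAt ℝ (fderiv ℝ g) x :=
      ((SmoothOn.fderiv hU hg).contDiffAt (hU.mem_nhds hx)).differentiableAt (by simp)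
    rw [pd_eq_fderiv (hd.clm_apply (differentiableAt_const _))]
    rw [fderiv_clm_apply hd (differentiableAt_const _)]
    simp
  rw [key, key]
  exact ((SmoothOn.at hU hg hx).isSymmSndFDerivAt (by
    rw [minSmoothness_of_isRCLikeNormedField]; exact two_le_inf)) _ _

lemma pd_add' {f g : Pl → ℝ} {x : Pl} (hf : DifferentiableAt ℝ f x) (hg : DifferentiableAt ℝ g x)
    (i : Fin 2) : pd (fun y => f y + g y) i x = pd f i x + pd g i x := by
  rw [pd_eq_fderiv (hf.fun_add hg), pd_eq_fderiv hf, pd_eq_fderiv hg, fderiv_fun_add hf hg]; rfl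

lemma lap_pd {g : Pl → ℝ} {U : Set Pl} (hU : IsOpen U) (hg : SmoothOn g U) (i : Fin 2)
    {x : Pl} (hx : x ∈ U) : lap (pd g i) x = pd (lap g) i x := by
  have key : ∀ l : Fin 2, pd (pd (pd g i) l) l x = pd (pd (pd g l) l) i x := by
    intro l
    rw [pd_congr hU (fun y hy => pd_comm hU hg i l hy) l hx]
    exact pd_comm hU (SmoothOn.pd hU hg l) i l hx
  have e : lap g = fun y => pd (pd g 0) 0 y + pd (pd g 1) 1 y := rfl
  rw [e, pd_add' (SmoothOn.diffAt hU (SmoothOn.pd hU (SmoothOn.pd hU hg 0) 0) hx)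
    (SmoothOn.diffAt hU (SmoothOn.pd hU (SmoothOn.pd hU hg 1) 1) hx)]
  unfold lap
  rw [key, key]

lemma iter_pd_le {g : Pl → ℝ} {U : Set Pl} (hU : IsOpen U) (hg : SmoothOn g U) (i : Fin 2) (m : ℕ)
    {x : Pl} (hx : x ∈ U) : ‖iteratedFDeriv ℝ m (pd g i) x‖ ≤ ‖iteratedFDeriv ℝ (m + 1) g x‖ := by
  have e : pd g i =ᶠ[𝓝 x] (ContinuousLinearMap.apply ℝ ℝ (bv i)) ∘ (fderiv ℝ g) := by
    filter_upwards [hU.mem_nhds hx] with y hy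
    exact pd_eq_fderiv (SmoothOn.diffAt hU hg hy) i
  rw [(e.iteratedFDeriv ℝ m).eq_of_nhds, ← norm_iteratedFDeriv_fderiv]
  have h := (ContinuousLinearMap.apply ℝ ℝ (bv i)).norm_iteratedFDeriv_comp_left (n := m)
    ((SmoothOn.fderiv hU hg).contDiffAt (hU.mem_nhds hx)) (by exact_mod_cast le_top)
  refine h.trans ?_
  have : ‖ContinuousLinearMap.apply ℝ ℝ (bv i)‖ ≤ 1 := by
    apply ContinuousLinearMap.opNorm_le_bound _ zero_le_one
    intro L
    have := L.le_opNorm (bv i)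
    simpa [bv] using this
  exact (mul_le_mul_of_nonneg_right this (norm_nonneg _)).trans (one_mul _).le

/-- The `i`-th coordinate functional. -/
def dx (i : Fin 2) : Pl →L[ℝ] ℝ := EuclideanSpace.proj i

lemma iter_succ_le {g : Pl → ℝ} {U : Set Pl} (hU : IsOpen U) (hg : SmoothOn g U) (m : ℕ)
    {x : Pl} (hx : x ∈ U) : ‖iteratedFDeriv ℝ (m + 1) g x‖ ≤
      ‖dx 0‖ * ‖iteratedFDeriv ℝ m (pd g 0) x‖ + ‖dx 1‖ * ‖iteratedFDeriv ℝ m (pd g 1) x‖ := by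
  let L : Fin 2 → (ℝ →L[ℝ] (Pl →L[ℝ] ℝ)) := fun i => (ContinuousLinearMap.id ℝ ℝ).smulRight (dx i)
  have hL : ∀ i, ‖L i‖ ≤ ‖dx i‖ := by
    intro i
    apply ContinuousLinearMap.opNorm_le_bound _ (norm_nonneg _)
    intro t; simp [L, norm_smul, mul_comm]
  have e : fderiv ℝ g =ᶠ[𝓝 x] (L 0 ∘ pd g 0) + (L 1 ∘ pd g 1) := by
    filter_upwards [hU.mem_nhds hx] with y hy
    ext v
    have hv : v = v 0 • bv 0 + v 1 • bv 1 := by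
      ext j; fin_cases j <;> simp [bv]
    conv_lhs => rw [hv]
    rw [map_add, map_smul, map_smul, ← pd_eq_fderiv (SmoothOn.diffAt hU hg hy),
      ← pd_eq_fderiv (SmoothOn.diffAt hU hg hy)]
    simp [L, dx, mul_comm]
  have hp : ∀ i, ContDiffAt ℝ (⊤ : ℕ∞) (pd g i) x := fun i => SmoothOn.at hU (SmoothOn.pd hU hg i) hx
  have hc : ∀ i, ContDiffAt ℝ m (L i ∘ pd g i) x := fun i =>
    ((L i).contDiff.contDiffAt.comp x (hp i)).of_le (by exact_mod_cast le_top)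
  rw [← norm_iteratedFDeriv_fderiv, (e.iteratedFDeriv ℝ m).eq_of_nhds,
    iteratedFDeriv_add_apply (hc 0) (hc 1)]
  refine (norm_add_le _ _).trans (add_le_add ?_ ?_)
  · exact ((L 0).norm_iteratedFDeriv_comp_left (hp 0) (by exact_mod_cast le_top)).trans
      (mul_le_mul_of_nonneg_right (hL 0) (norm_nonneg _))
  · exact ((L 1).norm_iteratedFDeriv_comp_left (hp 1) (by exact_mod_cast le_top)).trans
      (mul_le_mul_of_nonneg_right (hL 1) (norm_nonneg _))

/-! ### Negligible families -/

/-- A family is negligible on `U` if on each compact subset it is `O(ε^n)` for every `n`. -/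
def Negl (ε : ℕ → ℝ) (U : Set Pl) (g : ℕ → Pl → ℝ) : Prop :=
  ∀ K : Set Pl, IsCompact K → K ⊆ U → ∀ n : ℕ, ∃ C > 0, ∀ᶠ k in atTop, ∀ x ∈ K, |g k x| ≤ C * ε k ^ n

/-- The `m`-th derivatives form a negligible family. -/
def NegD (ε : ℕ → ℝ) (U : Set Pl) (m : ℕ) (g : ℕ → Pl → ℝ) : Prop :=
  Negl ε U (fun k x => ‖iteratedFDeriv ℝ m (g k) x‖)

lemma negD_zero {ε : ℕ → ℝ} {U : Set Pl} {g : ℕ → Pl → ℝ} : NegD ε U 0 g ↔ Negl ε U g := by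
  unfold NegD Negl; simp

lemma Negl.mono {ε : ℕ → ℝ} {U : Set Pl} {f g : ℕ → Pl → ℝ} (hg : Negl ε U g)
    (h : ∀ k, ∀ x ∈ U, |f k x| ≤ |g k x|) : Negl ε U f := by
  intro K hK hKU n
  obtain ⟨C, hC, hb⟩ := hg K hK hKU n
  refine ⟨C, hC, ?_⟩
  filter_upwards [hb] with k hk x hx using (h k x (hKU hx)).trans (hk x hx)

lemma Negl.lin {ε : ℕ → ℝ} {U : Set Pl} {f g : ℕ → Pl → ℝ} (hf : Negl ε U f)
    (hg : Negl ε U g) (a b : ℝ) : Negl ε U (fun k x => a * f k x + b * g k x) := by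
  intro K hK hKU n
  obtain ⟨C, hC, hb⟩ := hf K hK hKU n
  obtain ⟨C', hC', hb'⟩ := hg K hK hKU n
  refine ⟨|a| * C + |b| * C' + 1, by positivity, ?_⟩
  filter_upwards [hb, hb'] with k hk hk' x hx
  have h1 := hk x hx
  have h2 := hk' x hx
  have h3 : 0 ≤ ε k ^ n := by
    by_contra hneg
    push Not at hneg
    have := abs_nonneg (f k x)
    nlinarith
  calc |a * f k x + b * g k x| ≤ |a * f k x| + |b * g k x| := abs_add_le _ _
    _ = |a| * |f k x| + |b| * |g k x| := by rw [abs_mul, abs_mul]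
    _ ≤ |a| * (C * ε k ^ n) + |b| * (C' * ε k ^ n) := by gcongr
    _ ≤ _ := by nlinarith

lemma negl_pd {ε : ℕ → ℝ} (hε : ∀ n, 0 < ε n) {U : Set Pl} (hU : IsOpen U) {g : ℕ → Pl → ℝ}
    (hs : ∀ k, SmoothOn (g k) U) (hg : Negl ε U g) (hl : Negl ε U (fun k => lap (g k))) (i : Fin 2) :
    Negl ε U (fun k => pd (g k) i) := by
  intro K hK hKU n
  obtain ⟨R, hR, hRU⟩ := hK.exists_cthickening_subset_open hU hKU
  obtain ⟨C, hC, hb⟩ := hg _ (hK.cthickening (r := R)) hRU n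
  obtain ⟨C', hC', hb'⟩ := hl _ (hK.cthickening (r := R)) hRU n
  refine ⟨2 * C / (R / 2) + C' * (R / 2), by positivity, ?_⟩
  filter_upwards [hb, hb'] with k hk hk' x hx
  have hsub : closedBall x (2 * (R / 2)) ⊆ cthickening R K := by
    have : 2 * (R / 2) = R := by ring
    rw [this]; exact closedBall_subset_cthickening hx R
  have hp : 0 < ε k ^ n := pow_pos (hε k) n
  have := gradient_estimate (g := g k) (x0 := x) (d := R / 2) (M := C * ε k ^ n) (B := C' * ε k ^ n) i
    (by positivity) (by positivity) (by positivity)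
    (fun y hy => (SmoothOn.at hU (hs k) (hRU (hsub hy))).of_le two_le_inf)
    (fun y hy => hk y (hsub hy)) (fun y hy => hk' y (hsub hy))
  refine this.trans (le_of_eq ?_)
  ring

lemma negD_step {ε : ℕ → ℝ} (hε : ∀ n, 0 < ε n) {U : Set Pl} (hU : IsOpen U) (m : ℕ) :
    ∀ g : ℕ → Pl → ℝ, (∀ k, SmoothOn (g k) U) → (∀ i ≤ m, NegD ε U i g) →
      (∀ i ≤ m, NegD ε U i (fun k => lap (g k))) → NegD ε U (m + 1) g := by
  have fin : ∀ (m : ℕ) (g : ℕ → Pl → ℝ), (∀ k, SmoothOn (g k) U) →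
      (∀ i, NegD ε U m (fun k => pd (g k) i)) → NegD ε U (m + 1) g := by
    intro m g hs h
    refine Negl.mono (Negl.lin (h 0) (h 1) ‖dx 0‖ ‖dx 1‖) ?_
    intro k x hx
    rw [abs_of_nonneg (norm_nonneg _), abs_of_nonneg (by positivity)]
    exact iter_succ_le hU (hs k) m hx
  induction m with
  | zero =>
    intro g hs h h'
    apply fin 0 g hs
    intro i
    exact negD_zero.2 (negl_pd hε hU hs (negD_zero.1 (h 0 le_rfl)) (negD_zero.1 (h' 0 le_rfl)) i)
  | succ m ih =>
    intro g hs h h'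
    apply fin (m + 1) g hs
    intro i
    apply ih _ (fun k => SmoothOn.pd hU (hs k) i)
    · intro l hl
      refine Negl.mono (h (l + 1) (by omega)) ?_
      intro k x hx
      rw [abs_of_nonneg (norm_nonneg _), abs_of_nonneg (norm_nonneg _)]
      exact iter_pd_le hU (hs k) i l hx
    · intro l hl
      refine Negl.mono (h' (l + 1) (by omega)) ?_
      intro k x hx
      rw [abs_of_nonneg (norm_nonneg _), abs_of_nonneg (norm_nonneg _)]
      have e : lap (pd (g k) i) =ᶠ[𝓝 x] pd (lap (g k)) i := by
        filter_upwards [hU.mem_nhds hx] with y hy using lap_pd hU (hs k) i hy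
      rw [(e.iteratedFDeriv ℝ l).eq_of_nhds]
      exact iter_pd_le hU (SmoothOn.lap hU (hs k)) i l hx


/-! ### The vortex set is closed -/

lemma isClosed_unitLattice : IsClosed unitLattice := by
  have h : unitLattice = {x : Pl | x 0 ∈ range ((↑) : ℤ → ℝ)} ∩ {x : Pl | x 1 ∈ range ((↑) : ℤ → ℝ)} := by
    ext x
    constructor
    · rintro ⟨a, b, rfl⟩
      exact ⟨⟨a, by simp⟩, ⟨b, by simp⟩⟩
    · rintro ⟨⟨a, ha⟩, ⟨b, hb⟩⟩
      refine ⟨a, b, ?_⟩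
      ext j; fin_cases j
      · simp [ha]
      · simp [hb]
  rw [h]
  have hc : IsClosed (range ((↑) : ℤ → ℝ)) := Int.isClosedEmbedding_coe_real.isClosed_range
  exact (hc.preimage (by fun_prop : Continuous fun x : Pl => x 0)).inter
    (hc.preimage (by fun_prop : Continuous fun x : Pl => x 1))

lemma isClosed_translates {d : ℕ} (p : Fin d → Pl) :
    IsClosed {x : Pl | ∃ j v, v ∈ unitLattice ∧ x = p j + v} := by
  have : {x : Pl | ∃ j v, v ∈ unitLattice ∧ x = p j + v} = ⋃ j, (fun x => x - p j) ⁻¹' unitLattice := by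
    ext x
    simp only [mem_setOf_eq, mem_iUnion, mem_preimage]
    constructor
    · rintro ⟨j, v, hv, rfl⟩; exact ⟨j, by simpa using hv⟩
    · rintro ⟨j, hj⟩; exact ⟨j, _, hj, by simp⟩
  rw [this]
  exact isClosed_iUnion_of_finite fun j => isClosed_unitLattice.preimage (by fun_prop)

lemma isOpen_compl_Z (V : VortexData) : IsOpen (V.Z)ᶜ :=
  ((isClosed_translates V.p₁).union (isClosed_translates V.p₂)).isOpen_compl

/-! ### The nonlinearity -/

lemma fτ_contDiff {τ : ℝ} (hτ : 0 < τ) : ContDiff ℝ (⊤ : ℕ∞) (fτ τ) := by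
  unfold fτ
  apply ContDiff.div
  · fun_prop
  · fun_prop
  · intro t; positivity

lemma fτ_abs_le {τ : ℝ} (hτ : 0 < τ) {t : ℝ} (ht : |t| ≤ 1) : |fτ τ t| ≤ 2 / τ ^ 2 * |t| := by
  unfold fτ
  have he := Real.abs_exp_sub_one_le ht
  have hp := exp_pos t
  rw [abs_div, abs_mul, abs_of_pos hp, abs_of_pos (by positivity : 0 < (τ + exp t) ^ 3), abs_sub_comm,
    div_le_iff₀ (by positivity)]
  have h1 : exp t * τ ^ 2 ≤ (τ + exp t) ^ 3 := by nlinarith [mul_pos hp hτ, pow_pos hp 2, pow_pos hp 3, pow_pos hτ 3, mul_pos (pow_pos hp 2) hτ, mul_pos hp (pow_pos hτ 2)]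
  calc exp t * |exp t - 1| ≤ exp t * (2 * |t|) := by gcongr
    _ = 2 / τ ^ 2 * |t| * (exp t * τ ^ 2) := by field_simp
    _ ≤ _ := by gcongr

/-- The coercivity constant of `-fτ` near `0`. -/
def cA (τ : ℝ) : ℝ := exp (-1) * exp (-1) / (τ + exp 1) ^ 3

lemma cA_pos {τ : ℝ} (hτ : 0 < τ) : 0 < cA τ := by unfold cA; positivity

lemma fτ_coer {τ : ℝ} (hτ : 0 < τ) {t : ℝ} (ht : |t| ≤ 1) (w : ℝ)
    (hw : exp (-1) * w ≤ exp t - 1) (hw0 : 0 ≤ w) : cA τ * w ≤ - fτ τ t := by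
  obtain ⟨h1, h2⟩ := abs_le.1 ht
  have e1 : exp (-1) ≤ exp t := exp_le_exp.2 h1
  have e2 : exp t ≤ exp 1 := exp_le_exp.2 h2
  have hp := exp_pos t
  have h3 : 0 ≤ exp t - 1 := le_trans (by positivity) hw
  unfold cA fτ
  have : -(exp t * (1 - exp t) / (τ + exp t) ^ 3) = exp t * (exp t - 1) / (τ + exp t) ^ 3 := by ring
  rw [this]
  have : exp (-1) * exp (-1) / (τ + exp 1) ^ 3 * w = exp (-1) * (exp (-1) * w) / (τ + exp 1) ^ 3 := by ring
  rw [this]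
  gcongr

lemma fτ_coer' {τ : ℝ} (hτ : 0 < τ) {t : ℝ} (ht : |t| ≤ 1) (w : ℝ)
    (hw : exp (-1) * w ≤ 1 - exp t) (hw0 : 0 ≤ w) : cA τ * w ≤ fτ τ t := by
  obtain ⟨h1, h2⟩ := abs_le.1 ht
  have e1 : exp (-1) ≤ exp t := exp_le_exp.2 h1
  have e2 : exp t ≤ exp 1 := exp_le_exp.2 h2
  have hp := exp_pos t
  have h3 : 0 ≤ 1 - exp t := le_trans (by positivity) hw
  unfold cA fτ
  have : exp (-1) * exp (-1) / (τ + exp 1) ^ 3 * w = exp (-1) * (exp (-1) * w) / (τ + exp 1) ^ 3 := by ring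
  rw [this]
  gcongr

lemma fτ_pos_side {τ : ℝ} (hτ : 0 < τ) {t : ℝ} (ht : |t| ≤ 1) (h0 : 0 ≤ t) :
    cA τ * t ≤ - fτ τ t := by
  apply fτ_coer hτ ht t _ h0
  have := add_one_le_exp t
  have h1 : exp (-1) ≤ 1 := by rw [exp_le_one_iff]; norm_num
  nlinarith

lemma fτ_neg_side {τ : ℝ} (hτ : 0 < τ) {t : ℝ} (ht : |t| ≤ 1) (h0 : t ≤ 0) :
    cA τ * (-t) ≤ fτ τ t := by
  apply fτ_coer' hτ ht (-t) _ (by linarith)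
  have h2 := add_one_le_exp (-t)
  have h1 : exp (-1) ≤ exp t := exp_le_exp.2 (abs_le.1 ht).1
  have h3 : exp t * exp (-t) = 1 := by rw [← exp_add]; simp
  have hp := exp_pos t
  nlinarith

/-! ### Decay of topological solutions -/

section decay

variable {V : VortexData} {τ : ℝ} {ε : ℕ → ℝ} {u : ℕ → Pl → ℝ}

lemma u_small (htop : ∀ K : Set Pl, IsCompact K → K ⊆ (V.Z)ᶜ →
        TendstoUniformlyOn u (fun _ => (0:ℝ)) atTop K) {K : Set Pl} (hK : IsCompact K) (hKU : K ⊆ (V.Z)ᶜ)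
    {δ : ℝ} (hδ : 0 < δ) : ∀ᶠ k in atTop, ∀ x ∈ K, |u k x| ≤ δ := by
  have := Metric.tendstoUniformlyOn_iff.1 (htop K hK hKU) δ hδ
  filter_upwards [this] with k hk x hx
  have := hk x hx
  rw [dist_comm, dist_zero_right, Real.norm_eq_abs] at this
  exact this.le

lemma eps_le_one (hε0 : Tendsto ε atTop (nhds 0)) {δ : ℝ} (hδ : 0 < δ) : ∀ᶠ k in atTop, ε k ≤ δ := by
  filter_upwards [hε0.eventually (gt_mem_nhds hδ)] with k hk using hk.le

lemma u_decay (hτ : 0 < τ) (hε : ∀ n, 0 < ε n)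
    (hu : ∀ n, IsSolution V τ (ε n) (u n))
    (htop : ∀ K : Set Pl, IsCompact K → K ⊆ (V.Z)ᶜ →
        TendstoUniformlyOn u (fun _ => (0:ℝ)) atTop K) (n : ℕ) :
    ∀ K : Set Pl, IsCompact K → K ⊆ (V.Z)ᶜ → ∃ C > 0, ∀ᶠ k in atTop, ∀ x ∈ K, |u k x| ≤ C * (ε k ^ 2) ^ n := by
  have hU := isOpen_compl_Z V
  induction n with
  | zero =>
    intro K hK hKU
    exact ⟨1, one_pos, by simpa using u_small htop hK hKU one_pos⟩
  | succ n ih =>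
    intro K hK hKU
    obtain ⟨R, hR, hRU⟩ := hK.exists_cthickening_subset_open hU hKU
    have hKc := hK.cthickening (r := R)
    obtain ⟨C, hC, hb⟩ := ih _ hKc hRU
    have hA := cA_pos hτ
    refine ⟨4 * C / (R ^ 2 * cA τ), by positivity, ?_⟩
    filter_upwards [hb, u_small htop hKc hRU one_pos] with k hk h1 x hx
    have hsub : closedBall x R ⊆ cthickening R K := closedBall_subset_cthickening hx R
    have hεk := hε k
    have hsm : ∀ y ∈ closedBall x R, ContDiffAt ℝ 2 (u k) y := fun y hy =>
      (SmoothOn.at hU (hu k).smooth (hRU (hsub hy))).of_le two_le_inf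
    have hpde : ∀ y ∈ closedBall x R, lap (u k) y = - ((ε k ^ 2)⁻¹ * fτ τ (u k y)) := fun y hy => by
      have := (hu k).pde y (hRU (hsub hy))
      linarith
    have hEp : 0 < (ε k ^ 2)⁻¹ := by positivity
    have e : 4 * (C * (ε k ^ 2) ^ n) / (R ^ 2 * ((ε k ^ 2)⁻¹ * cA τ)) =
        4 * C / (R ^ 2 * cA τ) * (ε k ^ 2) ^ (n + 1) := by
      field_simp
      ring
    have up := decay_estimate (g := u k) (x0 := x) (R := R) (A := (ε k ^ 2)⁻¹ * cA τ)
      (M := C * (ε k ^ 2) ^ n) hR (by positivity) (by positivity) hsm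
      (fun y hy => (le_abs_self _).trans (hk y (hsub hy)))
      (fun y hy hp => by
        rw [hpde y hy, mul_assoc, ← mul_neg]
        exact mul_le_mul_of_nonneg_left (fτ_pos_side hτ (h1 y (hsub hy)) hp.le) hEp.le)
    have dn := decay_estimate (g := fun y => - u k y) (x0 := x) (R := R) (A := (ε k ^ 2)⁻¹ * cA τ)
      (M := C * (ε k ^ 2) ^ n) hR (by positivity) (by positivity) (fun y hy => (hsm y hy).neg)
      (fun y hy => (neg_le_abs _).trans (hk y (hsub hy)))
      (fun y hy hp => by
        rw [lap_neg, hpde y hy, mul_assoc, neg_neg]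
        exact mul_le_mul_of_nonneg_left (fτ_neg_side hτ (h1 y (hsub hy)) (by linarith)) hEp.le)
    rw [e] at up dn
    exact abs_le.2 ⟨by linarith, up⟩

lemma u_negl (hτ : 0 < τ) (hε : ∀ n, 0 < ε n) (hε0 : Tendsto ε atTop (nhds 0))
    (hu : ∀ n, IsSolution V τ (ε n) (u n))
    (htop : ∀ K : Set Pl, IsCompact K → K ⊆ (V.Z)ᶜ →
        TendstoUniformlyOn u (fun _ => (0:ℝ)) atTop K) : Negl ε (V.Z)ᶜ u := by
  intro K hK hKU n
  obtain ⟨C, hC, hb⟩ := u_decay hτ hε hu htop n K hK hKU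
  refine ⟨C, hC, ?_⟩
  filter_upwards [hb, eps_le_one hε0 one_pos] with k hk h1 x hx
  refine (hk x hx).trans ?_
  have hεk := hε k
  gcongr
  nlinarith

lemma comp_negD (hτ : 0 < τ) (hε : ∀ n, 0 < ε n) (hε0 : Tendsto ε atTop (nhds 0))
    (hu : ∀ n, IsSolution V τ (ε n) (u n))
    (htop : ∀ K : Set Pl, IsCompact K → K ⊆ (V.Z)ᶜ →
        TendstoUniformlyOn u (fun _ => (0:ℝ)) atTop K) (m : ℕ)
    (h : ∀ i ≤ m, NegD ε (V.Z)ᶜ i u) : NegD ε (V.Z)ᶜ m (fun k x => fτ τ (u k x)) := by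
  intro K hK hKU n
  have hU := isOpen_compl_Z V
  rcases Nat.eq_zero_or_pos m with rfl | hm
  · obtain ⟨C, hC, hb⟩ := negD_zero.1 (h 0 le_rfl) K hK hKU n
    refine ⟨2 / τ ^ 2 * C, by positivity, ?_⟩
    filter_upwards [hb, u_small htop hK hKU one_pos] with k hk h1 x hx
    rw [norm_iteratedFDeriv_zero, Real.norm_eq_abs, abs_abs]
    refine (fτ_abs_le hτ (h1 x hx)).trans ?_
    rw [mul_assoc]
    exact mul_le_mul_of_nonneg_left (hk x hx) (by positivity)
  · have hb : ∀ i : ℕ, ∃ C, ∀ t ∈ Icc (-1:ℝ) 1, ‖iteratedFDeriv ℝ i (fτ τ) t‖ ≤ C := fun i =>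
      isCompact_Icc.exists_bound_of_continuousOn
        ((fτ_contDiff hτ).continuous_iteratedFDeriv (by exact_mod_cast le_top)).continuousOn
    choose B hB using hb
    set C := ∑ i ∈ Finset.range (m + 1), |B i| + 1 with hC
    have hC0 : 0 < C := by positivity
    have hBC : ∀ i ≤ m, B i ≤ C := by
      intro i hi
      have := Finset.single_le_sum (f := fun i => |B i|) (fun i _ => abs_nonneg _)
        (Finset.mem_range.2 (Nat.lt_succ_of_le hi))
      have h2 := le_abs_self (B i)
      linarith
    refine ⟨m.factorial * C, by positivity, ?_⟩
    have hev : ∀ᶠ k in atTop, ∀ i ∈ Finset.range (m + 1), ∀ x ∈ K,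
        ‖iteratedFDeriv ℝ i (u k) x‖ ≤ ε k ^ (n * m) := by
      rw [eventually_all_finset]
      intro i hi
      obtain ⟨D, hD, hDb⟩ := h i (Nat.lt_succ_iff.1 (Finset.mem_range.1 hi)) K hK hKU (n * m + 1)
      filter_upwards [hDb, eps_le_one hε0 (by positivity : 0 < 1 / D)] with k hk h1 x hx
      have := hk x hx
      rw [abs_of_nonneg (norm_nonneg _)] at this
      refine this.trans ?_
      rw [pow_succ]
      have h2 : D * ε k ≤ 1 := by
        rw [le_div_iff₀ hD] at h1; linarith
      have h3 : 0 < ε k ^ (n * m) := pow_pos (hε k) _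
      nlinarith
    filter_upwards [hev, u_small htop hK hKU one_pos, eps_le_one hε0 one_pos] with k hk h1 he x hx
    rw [abs_of_nonneg (norm_nonneg _)]
    have hεk := hε k
    have key := norm_iteratedFDerivWithin_comp_le (g := fτ τ) (f := u k) (n := m) (s := (V.Z)ᶜ)
      (t := univ) (x := x) (fτ_contDiff hτ).contDiffOn (hu k).smooth
      (by exact_mod_cast le_top) uniqueDiffOn_univ hU.uniqueDiffOn (mapsTo_univ _ _) (hKU hx)
      (C := C) (D := ε k ^ n)
      (by
        intro i hi
        rw [iteratedFDerivWithin_univ]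
        exact (hB i _ (abs_le.1 (h1 x hx))).trans (hBC i hi))
      (by
        intro i hi1 hi
        rw [iteratedFDerivWithin_of_isOpen i hU (hKU hx)]
        refine (hk i (Finset.mem_range.2 (Nat.lt_succ_of_le hi)) x hx).trans ?_
        rw [← pow_mul]
        exact pow_le_pow_of_le_one hεk.le he (Nat.mul_le_mul_left n hi))
    rw [iteratedFDerivWithin_of_isOpen m hU (hKU hx)] at key
    refine key.trans ?_
    gcongr
    rw [← pow_mul]
    exact pow_le_pow_of_le_one hεk.le he (Nat.le_mul_of_pos_right n hm)

lemma lap_negD (hτ : 0 < τ) (hε : ∀ n, 0 < ε n) (hε0 : Tendsto ε atTop (nhds 0))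
    (hu : ∀ n, IsSolution V τ (ε n) (u n))
    (htop : ∀ K : Set Pl, IsCompact K → K ⊆ (V.Z)ᶜ →
        TendstoUniformlyOn u (fun _ => (0:ℝ)) atTop K) (m : ℕ)
    (h : ∀ i ≤ m, NegD ε (V.Z)ᶜ i u) : NegD ε (V.Z)ᶜ m (fun k => lap (u k)) := by
  intro K hK hKU n
  have hU := isOpen_compl_Z V
  obtain ⟨C, hC, hb⟩ := comp_negD hτ hε hε0 hu htop m h K hK hKU (n + 2)
  refine ⟨C, hC, ?_⟩
  filter_upwards [hb] with k hk x hx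
  have e : lap (u k) =ᶠ[𝓝 x] (-(ε k ^ 2)⁻¹) • (fun y => fτ τ (u k y)) := by
    filter_upwards [hU.mem_nhds (hKU hx)] with y hy
    have := (hu k).pde y hy
    simp only [Pi.smul_apply, smul_eq_mul]
    linarith
  have hs : ContDiffAt ℝ m (fun y => fτ τ (u k y)) x :=
    ContDiffAt.comp (g := fτ τ) x ((fτ_contDiff hτ).contDiffAt.of_le (by exact_mod_cast le_top))
      ((SmoothOn.at hU (hu k).smooth (hKU hx)).of_le (by exact_mod_cast le_top))
  have hk' := hk x hx
  rw [abs_of_nonneg (norm_nonneg _)] at hk' ⊢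
  rw [(e.iteratedFDeriv ℝ m).eq_of_nhds, iteratedFDeriv_const_smul_apply hs, norm_smul, norm_neg,
    Real.norm_eq_abs]
  have hεk := hε k
  rw [abs_of_pos (by positivity), inv_mul_le_iff₀ (by positivity)]
  refine hk'.trans (le_of_eq ?_)
  ring

lemma all_negD (hτ : 0 < τ) (hε : ∀ n, 0 < ε n) (hε0 : Tendsto ε atTop (nhds 0))
    (hu : ∀ n, IsSolution V τ (ε n) (u n))
    (htop : ∀ K : Set Pl, IsCompact K → K ⊆ (V.Z)ᶜ →
        TendstoUniformlyOn u (fun _ => (0:ℝ)) atTop K) (m : ℕ) : NegD ε (V.Z)ᶜ m u := by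
  induction m using Nat.strong_induction_on with
  | _ m ih =>
    rcases m with _ | m
    · exact negD_zero.2 (u_negl hτ hε hε0 hu htop)
    · exact negD_step hε (isOpen_compl_Z V) m u (fun k => (hu k).smooth)
        (fun i hi => ih i (by omega))
        (fun i hi => lap_negD hτ hε hε0 hu htop i (fun l hl => ih l (by omega)))

lemma part_one (hτ : 0 < τ) (hε : ∀ n, 0 < ε n) (hε0 : Tendsto ε atTop (nhds 0))
    (hu : ∀ n, IsSolution V τ (ε n) (u n))
    (htop : ∀ K : Set Pl, IsCompact K → K ⊆ (V.Z)ᶜ →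
        TendstoUniformlyOn u (fun _ => (0:ℝ)) atTop K) (K : Set Pl) (hK : IsCompact K)
    (hKU : K ⊆ (V.Z)ᶜ) (m n : ℕ) : ∃ C > 0, ∀ᶠ k in atTop, ∀ x ∈ K,
        (∑ i ∈ Finset.range (m + 1), ‖iteratedFDeriv ℝ i (u k) x‖) ≤ C * (ε k) ^ n := by
  have := fun i => all_negD hτ hε hε0 hu htop i K hK hKU n
  choose C hC hb using this
  refine ⟨∑ i ∈ Finset.range (m + 1), C i, Finset.sum_pos (fun i _ => hC i) ⟨0, by simp⟩, ?_⟩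
  have := (eventually_all_finset (Finset.range (m + 1))).2 (fun i _ => hb i)
  filter_upwards [this] with k hk x hx
  rw [Finset.sum_mul]
  apply Finset.sum_le_sum
  intro i hi
  have := hk i hi x hx
  rwa [abs_of_nonneg (norm_nonneg _)] at this

end decay


/-! ### Pohozaev identity -/

lemma supp_contDiff {U K : Set Pl} (hU : IsOpen U) (hK : IsCompact K) (hKU : K ⊆ U) {f : Pl → ℝ}
    (hf : SmoothOn f U) (h0 : ∀ x ∉ K, f x = 0) : ContDiff ℝ (⊤ : ℕ∞) f ∧ HasCompactSupport f := by
  refine ⟨?_, HasCompactSupport.intro hK h0⟩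
  rw [contDiff_iff_contDiffAt]
  intro x
  by_cases hx : x ∈ U
  · exact SmoothOn.at hU hf hx
  · have : f =ᶠ[𝓝 x] fun _ => 0 := by
      filter_upwards [hK.isClosed.isOpen_compl.mem_nhds (fun h => hx (hKU h))] with y hy using h0 y hy
    exact contDiffAt_const.congr_of_eventuallyEq this

lemma supp_integrable {U K : Set Pl} (hU : IsOpen U) (hK : IsCompact K) (hKU : K ⊆ U) {f : Pl → ℝ}
    (hf : SmoothOn f U) (h0 : ∀ x ∉ K, f x = 0) : Integrable f := by
  obtain ⟨h1, h2⟩ := supp_contDiff hU hK hKU hf h0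
  exact h1.continuous.integrable_of_hasCompactSupport h2

lemma supp_integral {U K : Set Pl} (hU : IsOpen U) (hK : IsCompact K) (hKU : K ⊆ U) {f : Pl → ℝ}
    (hf : SmoothOn f U) (h0 : ∀ x ∉ K, f x = 0) (v : Pl) (D : Pl → ℝ)
    (hD : ∀ x ∈ U, HasLineDerivAt ℝ f (D x) x v) (hD0 : ∀ x ∉ K, D x = 0) :
    Integrable D ∧ ∫ x, D x = 0 := by
  obtain ⟨h1, h2⟩ := supp_contDiff hU hK hKU hf h0
  have hd : Differentiable ℝ f := h1.differentiable (by simp)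
  have e : D = fun x => fderiv ℝ f x v := by
    funext x
    by_cases hx : x ∈ U
    · exact (hD x hx).lineDeriv.symm.trans (hd x).lineDeriv_eq_fderiv
    · have hx' : x ∉ K := fun h => hx (hKU h)
      have : f =ᶠ[𝓝 x] fun _ => 0 := by
        filter_upwards [hK.isClosed.isOpen_compl.mem_nhds hx'] with y hy using h0 y hy
      rw [hD0 x hx', this.fderiv_eq]; simp
  have hi : Integrable (fun x => fderiv ℝ f x v) := by
    apply Continuous.integrable_of_hasCompactSupport
    · exact (h1.continuous_fderiv (by simp)).clm_apply continuous_const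
    · exact (h2.fderiv ℝ).comp_left (g := fun L : Pl →L[ℝ] ℝ => L v) (by simp)
  refine ⟨e ▸ hi, ?_⟩
  rw [e]
  have hf' := h1.continuous.integrable_of_hasCompactSupport (μ := volume) h2
  have := integral_mul_fderiv_eq_neg_fderiv_mul_of_integrable (𝕜 := ℝ) (μ := (volume : Measure Pl))
    (f := fun _ => (1:ℝ)) (g := f) (v := v) (by simp) (by simpa using hi) (by simpa using hf')
    (fun x _ => differentiableAt_const _) (fun x _ => hd x)
  simpa using this

/-- The Pohozaev quadratic expression. -/
def Qf (u : Pl → ℝ) (q x : Pl) : ℝ :=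
  2 * ((x 0 - q 0) * pd u 0 x + (x 1 - q 1) * pd u 1 x) ^ 2
    - ((x 0 - q 0) ^ 2 + (x 1 - q 1) ^ 2) * ((pd u 0 x) ^ 2 + (pd u 1 x) ^ 2)

/-- squared distance in coordinates -/
def dsq (q x : Pl) : ℝ := (x 0 - q 0) ^ 2 + (x 1 - q 1) ^ 2

lemma dsq_eq (q x : Pl) : dsq q x = ‖x - q‖ ^ 2 := by rw [normsq_eq]; rfl

lemma dsq_nonneg (q x : Pl) : 0 ≤ dsq q x := by unfold dsq; positivity

lemma coord_contDiff (q : Pl) (i : Fin 2) : ContDiff ℝ (⊤ : ℕ∞) (fun x : Pl => x i - q i) :=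
  ContDiff.sub (EuclideanSpace.proj i : Pl →L[ℝ] ℝ).contDiff contDiff_const

lemma dsq_contDiff (q : Pl) : ContDiff ℝ (⊤ : ℕ∞) (dsq q) :=
  ((coord_contDiff q 0).pow 2).add ((coord_contDiff q 1).pow 2)

lemma line_of_deriv {f : Pl → ℝ} {f' : ℝ} {x v : Pl} (g : ℝ → ℝ) (hg : HasDerivAt g f' 0)
    (h : ∀ t : ℝ, f (x + t • v) = g t) : HasLineDerivAt ℝ f f' x v := by
  have e : (fun t : ℝ => f (x + t • v)) = g := funext h
  unfold HasLineDerivAt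
  rw [e]; exact hg

lemma coord_line (q x : Pl) (i : Fin 2) : HasLineDerivAt ℝ (fun x : Pl => x i - q i) 1 x (bv i) := by
  have : HasDerivAt (fun t : ℝ => x i + t - q i) 1 0 := by
    simpa using ((hasDerivAt_id (0:ℝ)).const_add (x i)).sub_const (q i)
  exact line_of_deriv _ this (fun t => by simp [bv])

lemma coord_line_ne (q x : Pl) {i j : Fin 2} (h : i ≠ j) :
    HasLineDerivAt ℝ (fun x : Pl => x j - q j) 0 x (bv i) := by
  have : HasDerivAt (fun t : ℝ => x j - q j) 0 0 := hasDerivAt_const _ _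
  exact line_of_deriv _ this (fun t => by simp [bv, Ne.symm h])

lemma line_of_smooth {U : Set Pl} (hU : IsOpen U) {g : Pl → ℝ} (hg : SmoothOn g U) (i : Fin 2) {x : Pl}
    (hx : x ∈ U) : HasLineDerivAt ℝ g (pd g i x) x (bv i) :=
  ((SmoothOn.diffAt hU hg hx).lineDifferentiableAt (v := bv i)).hasLineDerivAt

lemma line_mul {f g : Pl → ℝ} {f' g' : ℝ} {x v : Pl} (hf : HasLineDerivAt ℝ f f' x v)
    (hg : HasLineDerivAt ℝ g g' x v) : HasLineDerivAt ℝ (fun y => f y * g y) (f' * g x + f x * g') x v := by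
  have := HasDerivAt.mul hf hg
  simp only [zero_smul, add_zero] at this
  exact this

lemma line_add {f g : Pl → ℝ} {f' g' : ℝ} {x v : Pl} (hf : HasLineDerivAt ℝ f f' x v)
    (hg : HasLineDerivAt ℝ g g' x v) : HasLineDerivAt ℝ (fun y => f y + g y) (f' + g') x v :=
  HasDerivAt.add hf hg

lemma line_sub {f g : Pl → ℝ} {f' g' : ℝ} {x v : Pl} (hf : HasLineDerivAt ℝ f f' x v)
    (hg : HasLineDerivAt ℝ g g' x v) : HasLineDerivAt ℝ (fun y => f y - g y) (f' - g') x v :=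
  HasDerivAt.sub hf hg

lemma line_cmul {f : Pl → ℝ} {f' : ℝ} {x v : Pl} (c : ℝ) (hf : HasLineDerivAt ℝ f f' x v) :
    HasLineDerivAt ℝ (fun y => c * f y) (c * f') x v :=
  HasDerivAt.const_mul c hf

lemma line_comp {f : Pl → ℝ} {f' : ℝ} {x v : Pl} {g : ℝ → ℝ} {g' : ℝ} (hg : HasDerivAt g g' (f x))
    (hf : HasLineDerivAt ℝ f f' x v) :
    HasLineDerivAt ℝ (fun y => g (f y)) (g' * f') x v := by
  have hg' : HasDerivAt g g' (f (x + (0:ℝ) • v)) := by simpa using hg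
  exact HasDerivAt.comp (0:ℝ) hg' hf

lemma dsq_line (q x : Pl) (i : Fin 2) : HasLineDerivAt ℝ (dsq q) (2 * (x i - q i)) x (bv i) := by
  have h1 := line_mul (coord_line q x i) (coord_line q x i)
  unfold dsq
  fin_cases i
  · have h2 := line_mul (coord_line_ne q x (i := 0) (j := 1) (by decide)) (coord_line_ne q x (i := 0) (j := 1) (by decide))
    have h3 := line_add h1 h2
    simp only [← pow_two] at h3
    convert h3 using 1
    simp; ring
  · have h2 := line_mul (coord_line_ne q x (i := 1) (j := 0) (by decide)) (coord_line_ne q x (i := 1) (j := 0) (by decide))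
    have h3 := line_add h2 h1
    simp only [← pow_two] at h3
    convert h3 using 1
    · simp
    · simp; ring
    · rfl

lemma annulus_compact (q : Pl) (t1 t2 : ℝ) : IsCompact {x : Pl | dsq q x ∈ Icc t1 t2} := by
  apply Metric.isCompact_of_isClosed_isBounded
  · exact isClosed_Icc.preimage (dsq_contDiff q).continuous
  · apply (Metric.isBounded_closedBall (x := q) (r := √(t2))).subset
    intro x hx
    have h := hx.2
    rw [dsq_eq] at h
    rw [mem_closedBall, dist_eq_norm]
    exact Real.le_sqrt_of_sq_le h

lemma deriv_zero_off {k : ℝ → ℝ} {t1 t2 : ℝ} (h : ∀ t ∉ Icc t1 t2, k t = 0) {t : ℝ} (ht : t ∉ Icc t1 t2) :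
    deriv k t = 0 := by
  have : k =ᶠ[𝓝 t] fun _ => 0 := by
    filter_upwards [isClosed_Icc.isOpen_compl.mem_nhds ht] with y hy using h y hy
  rw [this.deriv_eq]; simp

lemma Qf_smooth {U : Set Pl} (hU : IsOpen U) {u : Pl → ℝ} (hu : SmoothOn u U) (q : Pl) :
    SmoothOn (Qf u q) U := by
  have h0 := SmoothOn.pd hU hu 0
  have h1 := SmoothOn.pd hU hu 1
  have c0 := (coord_contDiff q 0).contDiffOn (s := U)
  have c1 := (coord_contDiff q 1).contDiffOn (s := U)
  exact (contDiffOn_const.mul (((c0.mul h0).add (c1.mul h1)).pow 2)).sub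
    (((c0.pow 2).add (c1.pow 2)).mul ((h0.pow 2).add (h1.pow 2)))

lemma pohozaev {U : Set Pl} (hU : IsOpen U) {u : Pl → ℝ} (hu : SmoothOn u U) {G : ℝ → ℝ}
    (hG : ContDiff ℝ (⊤ : ℕ∞) G) {β : ℝ} (pde : ∀ x ∈ U, lap u x = β * deriv G (u x)) (q : Pl)
    {k : ℝ → ℝ} (hk : ContDiff ℝ (⊤ : ℕ∞) k) {t1 t2 : ℝ} (h0 : ∀ t ∉ Icc t1 t2, k t = 0)
    (hKU : {x : Pl | dsq q x ∈ Icc t1 t2} ⊆ U) :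
    ∫ x, deriv k (dsq q x) * Qf u q x = 2 * β * ∫ x, (k (dsq q x) + dsq q x * deriv k (dsq q x)) * G (u x) := by
  have hK := annulus_compact q t1 t2
  have s0 := SmoothOn.pd hU hu 0
  have s1 := SmoothOn.pd hU hu 1
  have c0 := (coord_contDiff q 0).contDiffOn (s := U)
  have c1 := (coord_contDiff q 1).contDiffOn (s := U)
  have hκ : ContDiffOn ℝ (⊤ : ℕ∞) (fun x => k (dsq q x)) U := (hk.comp (dsq_contDiff q)).contDiffOn
  have hk' : ContDiff ℝ (⊤ : ℕ∞) (deriv k) := by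
    exact ((contDiff_infty_iff_deriv (𝕜 := ℝ)).1 hk).2
  have hκ' : ContDiffOn ℝ (⊤ : ℕ∞) (fun x => deriv k (dsq q x)) U := (hk'.comp (dsq_contDiff q)).contDiffOn
  have hGu : ContDiffOn ℝ (⊤ : ℕ∞) (fun x => G (u x)) U := hG.comp_contDiffOn hu
  have hE : ContDiffOn ℝ (⊤ : ℕ∞) (fun x => (1/2) * (pd u 0 x * pd u 0 x + pd u 1 x * pd u 1 x) + β * G (u x)) U :=
    (contDiffOn_const.mul ((s0.mul s0).add (s1.mul s1))).add (contDiffOn_const.mul hGu)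
  have hS : ContDiffOn ℝ (⊤ : ℕ∞) (fun x : Pl => (x 0 - q 0) * pd u 0 x + (x 1 - q 1) * pd u 1 x) U :=
    (c0.mul s0).add (c1.mul s1)
  have dk : ∀ t, HasDerivAt k (deriv k t) t := fun t => (hk.differentiable (by simp) t).hasDerivAt
  have dG : ∀ t, HasDerivAt G (deriv G t) t := fun t => (hG.differentiable (by simp) t).hasDerivAt
  have A0 := supp_integral hU hK hKU (hκ.mul ((hS.mul s0).sub (c0.mul hE)))
    (fun x hx => by simp [h0 _ hx]) (bv 0) _
    (fun x hx => line_mul (line_comp (dk _) (dsq_line q x 0))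
      (line_sub (line_mul (line_add (line_mul (coord_line q x 0) (line_of_smooth hU s0 0 hx))
        (line_mul (coord_line_ne q x (i := 0) (j := 1) (by decide)) (line_of_smooth hU s1 0 hx))) (line_of_smooth hU s0 0 hx))
        (line_mul (coord_line q x 0) (line_add (line_cmul (1/2) (line_add
          (line_mul (line_of_smooth hU s0 0 hx) (line_of_smooth hU s0 0 hx))
          (line_mul (line_of_smooth hU s1 0 hx) (line_of_smooth hU s1 0 hx))))
          (line_cmul β (line_comp (dG _) (line_of_smooth hU hu 0 hx)))))))
    (fun x hx => by simp [h0 _ hx, deriv_zero_off h0 hx])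
  have A1 := supp_integral hU hK hKU (hκ.mul ((hS.mul s1).sub (c1.mul hE)))
    (fun x hx => by simp [h0 _ hx]) (bv 1) _
    (fun x hx => line_mul (line_comp (dk _) (dsq_line q x 1))
      (line_sub (line_mul (line_add (line_mul (coord_line_ne q x (i := 1) (j := 0) (by decide)) (line_of_smooth hU s0 1 hx))
        (line_mul (coord_line q x 1) (line_of_smooth hU s1 1 hx))) (line_of_smooth hU s1 1 hx))
        (line_mul (coord_line q x 1) (line_add (line_cmul (1/2) (line_add
          (line_mul (line_of_smooth hU s0 1 hx) (line_of_smooth hU s0 1 hx))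
          (line_mul (line_of_smooth hU s1 1 hx) (line_of_smooth hU s1 1 hx))))
          (line_cmul β (line_comp (dG _) (line_of_smooth hU hu 1 hx)))))))
    (fun x hx => by simp [h0 _ hx, deriv_zero_off h0 hx])
  have IQ : Integrable (fun x => deriv k (dsq q x) * Qf u q x) :=
    supp_integrable hU hK hKU (hκ'.mul (Qf_smooth hU hu q)) (fun x hx => by simp [deriv_zero_off h0 hx])
  have IG : Integrable (fun x => (k (dsq q x) + dsq q x * deriv k (dsq q x)) * G (u x)) :=
    supp_integrable hU hK hKU ((hκ.add ((dsq_contDiff q).contDiffOn.mul hκ')).mul hGu)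
      (fun x hx => by simp [h0 _ hx, deriv_zero_off h0 hx])
  have S := integral_add A0.1 A1.1
  rw [A0.2, A1.2, add_zero] at S
  rw [← sub_eq_zero, ← integral_const_mul, ← integral_sub IQ (IG.const_mul _), ← S]
  congr 1
  funext x
  by_cases hx : x ∈ {x : Pl | dsq q x ∈ Icc t1 t2}
  · have hc := pd_comm hU hu 0 1 (hKU hx)
    have hl := pde x (hKU hx)
    unfold lap at hl
    have hl' : pd (pd u 1) 1 x = β * deriv G (u x) - pd (pd u 0) 0 x := by linarith
    simp only [Pi.mul_apply, Pi.sub_apply, Pi.add_apply]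
    rw [hc, hl']
    unfold Qf
    have e : dsq q x = (x 0 - q 0) ^ 2 + (x 1 - q 1) ^ 2 := rfl
    generalize deriv k (dsq q x) = k'
    generalize k (dsq q x) = kk
    rw [e]
    ring
  · simp [h0 _ hx, deriv_zero_off h0 hx]


/-! ### Cutoff -/

/-- smooth cutoff, one for `t ≤ 1` and zero for `t ≥ 2` -/
def Th (t : ℝ) : ℝ := Real.smoothTransition (2 - t)

lemma Th_contDiff : ContDiff ℝ (⊤ : ℕ∞) Th :=
  Real.smoothTransition.contDiff.comp (contDiff_const.sub contDiff_id)

lemma Th_one {t : ℝ} (h : t ≤ 1) : Th t = 1 := Real.smoothTransition.one_of_one_le (by linarith)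

lemma Th_zero {t : ℝ} (h : 2 ≤ t) : Th t = 0 := Real.smoothTransition.zero_of_nonpos (by linarith)

lemma Th_nonneg (t : ℝ) : 0 ≤ Th t := Real.smoothTransition.nonneg _

lemma Th_le_one (t : ℝ) : Th t ≤ 1 := Real.smoothTransition.le_one _

lemma Th_hasDeriv (t : ℝ) : HasDerivAt Th (deriv Th t) t :=
  (Th_contDiff.differentiable (by simp) t).hasDerivAt

lemma Th_deriv_contDiff : ContDiff ℝ (⊤ : ℕ∞) (deriv Th) :=
  ((contDiff_infty_iff_deriv (𝕜 := ℝ)).1 Th_contDiff).2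

lemma Th_deriv_zero {t : ℝ} (ht : t ∉ Icc (1:ℝ) 2) : deriv Th t = 0 := by
  rw [mem_Icc, not_and_or, not_le, not_le] at ht
  rcases ht with h | h
  · have : Th =ᶠ[𝓝 t] fun _ => 1 := by
      filter_upwards [Iio_mem_nhds h] with y hy using Th_one (le_of_lt hy)
    rw [this.deriv_eq]; simp
  · have : Th =ᶠ[𝓝 t] fun _ => 0 := by
      filter_upwards [Ioi_mem_nhds h] with y hy using Th_zero (le_of_lt hy)
    rw [this.deriv_eq]; simp

lemma Th_deriv_bdd : ∃ B > 0, ∀ t, |deriv Th t| ≤ B := by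
  obtain ⟨B, hB⟩ := (isCompact_Icc (a := (1:ℝ)) (b := 2)).exists_bound_of_continuousOn
    Th_deriv_contDiff.continuous.continuousOn
  refine ⟨|B| + 1, by positivity, fun t => ?_⟩
  by_cases ht : t ∈ Icc (1:ℝ) 2
  · have := hB t ht
    rw [Real.norm_eq_abs] at this
    have := le_abs_self B
    linarith
  · rw [Th_deriv_zero ht]; simp; positivity

/-- the mass of the derivative of the rescaled cutoff -/
lemma Th_mass (q : Pl) {s : ℝ} (hs : 0 < s) : ∫ x, deriv Th (dsq q x / s) / s = -π := by
  have e1 : ∀ x, deriv Th (dsq q x / s) / s = (fun y : Pl => (fun r : ℝ => deriv Th (r ^ 2 / s) / s) ‖y‖) (x - q) := by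
    intro x; rw [dsq_eq]
  simp_rw [e1]
  rw [integral_sub_right_eq_self (μ := (volume : Measure Pl))
    (fun y : Pl => (fun r : ℝ => deriv Th (r ^ 2 / s) / s) ‖y‖) q]
  refine (integral_fun_norm_addHaar (volume : Measure Pl) (fun r : ℝ => deriv Th (r ^ 2 / s) / s)).trans ?_
  have e2 : ∀ y : ℝ, y ^ (Module.finrank ℝ Pl - 1) • (deriv Th (y ^ 2 / s) / s) =
      deriv (fun r : ℝ => (1/2) * Th (r ^ 2 / s)) y := by
    intro y
    have h : HasDerivAt (fun r : ℝ => (1/2) * Th (r ^ 2 / s)) ((1/2) * (deriv Th (y ^ 2 / s) * (2 * y / s))) y := by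
      have h1 : HasDerivAt (fun r : ℝ => r ^ 2 / s) (2 * y / s) y := by
        simpa using (hasDerivAt_pow 2 y).div_const s
      exact ((Th_hasDeriv _).comp y h1).const_mul _
    rw [h.deriv]
    simp
    ring
  simp_rw [e2]
  have hc : ContDiff ℝ 1 (fun r : ℝ => (1/2) * Th (r ^ 2 / s)) :=
    contDiff_const.mul ((Th_contDiff.of_le (by simp)).comp ((contDiff_id.pow 2).div_const s))
  have hs' : HasCompactSupport (fun r : ℝ => (1/2) * Th (r ^ 2 / s)) := by
    apply HasCompactSupport.intro (isCompact_Icc (a := -(√(2 * s))) (b := √(2*s)))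
    intro x hx
    have : 2 * s < x ^ 2 := by
      by_contra h
      push Not at h
      exact hx (abs_le.1 (Real.abs_le_sqrt h))
    rw [Th_zero (by rw [le_div_iff₀ hs]; exact this.le), mul_zero]
  rw [hs'.integral_Ioi_deriv_eq hc]
  have hv : (volume : Measure Pl).real (ball 0 1) = π := by
    rw [measureReal_def, EuclideanSpace.volume_ball_fin_two]
    simp [Real.pi_pos.le]
  rw [hv, Th_one (by simp)]
  simp
  ring

lemma bound_int (q : Pl) {F : Pl → ℝ} {C s : ℝ} (hs : 0 < s) (h0 : ∀ x, 2 * s < dsq q x → F x = 0)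
    (hb : ∀ x, dsq q x ≤ 2 * s → |F x| ≤ C) : |∫ x, F x| ≤ C * (2 * s * π) := by
  have e : ∀ x : Pl, x ∈ closedBall q (√(2*s)) ↔ dsq q x ≤ 2 * s := by
    intro x
    rw [mem_closedBall, dist_eq_norm, dsq_eq, Real.le_sqrt (norm_nonneg _) (by positivity)]
  rw [← setIntegral_eq_integral_of_forall_compl_eq_zero (s := closedBall q (√(2*s)))
    (fun x hx => h0 x (by rw [e] at hx; linarith))]
  have := norm_setIntegral_le_of_norm_le_const (μ := (volume : Measure Pl)) (f := F) (C := C)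
    (s := closedBall q (√(2*s))) measure_closedBall_lt_top (fun x hx => hb x ((e x).1 hx))
  rw [Real.norm_eq_abs] at this
  refine this.trans (le_of_eq ?_)
  congr 1
  rw [measureReal_def, EuclideanSpace.volume_closedBall_fin_two]
  simp [Real.pi_pos.le, ENNReal.toReal_ofReal, Real.sqrt_nonneg, hs.le]
  rw [mul_pow, Real.sq_sqrt (by norm_num), Real.sq_sqrt hs.le]

/-! ### Behaviour of the Pohozaev expression at a logarithmic singularity -/

lemma Qf_limit {u : Pl → ℝ} {q : Pl} {a : ℝ} (h : LogSing u q a) {η : ℝ} (hη : 0 < η) :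
    ∃ δ > 0, ∀ x, x ≠ q → dsq q x < δ → |Qf u q x - 4 * a ^ 2| ≤ η := by
  obtain ⟨r, hr, v, hv, huv⟩ := h
  have hB : IsOpen (ball q r) := isOpen_ball
  have s0 := SmoothOn.pd hB hv 0
  have s1 := SmoothOn.pd hB hv 1
  have c0 := (coord_contDiff q 0).contDiffOn (s := ball q r)
  have c1 := (coord_contDiff q 1).contDiffOn (s := ball q r)
  have hS : ContDiffOn ℝ (⊤ : ℕ∞) (fun x : Pl => (x 0 - q 0) * pd v 0 x + (x 1 - q 1) * pd v 1 x) (ball q r) :=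
    (c0.mul s0).add (c1.mul s1)
  set H : Pl → ℝ := fun x => 4 * a ^ 2 + 4 * a * ((x 0 - q 0) * pd v 0 x + (x 1 - q 1) * pd v 1 x)
    + Qf v q x with hH
  have hHs : SmoothOn H (ball q r) :=
    (contDiffOn_const.add (contDiffOn_const.mul hS)).add (Qf_smooth hB hv q)
  have hHc : ContinuousAt H q := (SmoothOn.at hB hHs (mem_ball_self hr)).continuousAt
  have hHq : H q = 4 * a ^ 2 := by simp [hH, Qf]
  have hev := hHc.eventually (Metric.closedBall_mem_nhds (H q) hη)
  obtain ⟨δ, hδ, hball⟩ := Metric.eventually_nhds_iff.1 hev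
  refine ⟨(min δ r) ^ 2, by positivity, fun x hxq hx => ?_⟩
  rw [dsq_eq, sq_lt_sq₀ (norm_nonneg _) (by positivity), ← dist_eq_norm] at hx
  have hxr : x ∈ ball q r := hx.trans_le (min_le_right _ _)
  have h1 := hball (hx.trans_le (min_le_left _ _))
  rw [Real.dist_eq, hHq] at h1
  have hd0 : 0 < dsq q x := by
    rw [dsq_eq]; have := norm_pos_iff.2 (sub_ne_zero.2 hxq); positivity
  have hpd : ∀ i, pd u i x = 2 * a * (x i - q i) / dsq q x + pd v i x := by
    intro i
    have hO : IsOpen (ball q r ∩ {q}ᶜ) := hB.inter isOpen_compl_singleton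
    have hxO : x ∈ ball q r ∩ {q}ᶜ := ⟨hxr, hxq⟩
    have e : ∀ y ∈ ball q r ∩ {q}ᶜ, u y = a * Real.log (dsq q y) + v y := by
      intro y hy
      rw [huv y hy.1 hy.2, dsq_eq, Real.log_pow]; push_cast; ring
    rw [pd_congr hO e i hxO]
    have hl := line_add (line_cmul a (line_comp (Real.hasDerivAt_log hd0.ne') (dsq_line q x i)))
      (line_of_smooth hB hv i hxr)
    have := hl.lineDeriv
    change lineDeriv ℝ _ x (bv i) = _
    rw [this]
    field_simp
  have hQ : Qf u q x = H x := by
    have e : dsq q x = (x 0 - q 0) ^ 2 + (x 1 - q 1) ^ 2 := rfl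
    simp only [hH]
    unfold Qf
    rw [hpd 0, hpd 1, ← e]
    generalize pd v 0 x = A
    generalize pd v 1 x = B
    generalize dsq q x = D at *
    generalize x 0 - q 0 = X at *
    generalize x 1 - q 1 = Y at *
    have hD : D ≠ 0 := hd0.ne'
    have e1 : X * (2 * a * X / D + A) + Y * (2 * a * Y / D + B) = 2 * a + (X * A + Y * B) := by
      field_simp; rw [e]; ring
    have e2 : D * ((2 * a * X / D + A) ^ 2 + (2 * a * Y / D + B) ^ 2) =
        4 * a ^ 2 + 4 * a * (X * A + Y * B) + D * (A ^ 2 + B ^ 2) := by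
      field_simp; rw [e]; ring
    rw [e1, e2]; ring
  rw [hQ]; exact h1


lemma eq_zero_of_small {X C : ℝ} (hC : 0 < C) (h : ∀ η > 0, |X| ≤ C * η) : X = 0 := by
  by_contra hX
  have h1 : 0 < |X| := abs_pos.2 hX
  have h2 := h (|X| / (2 * C)) (by positivity)
  have : C * (|X| / (2 * C)) = |X| / 2 := by field_simp
  linarith

/-- first boundary-type integrand -/
def J1 (u : Pl → ℝ) (q : Pl) (s : ℝ) (x : Pl) : ℝ := deriv Th (dsq q x / s) / s * Qf u q x

/-- cutoff multiplier in the second integrand -/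
def mu2 (t : ℝ) : ℝ := Th t + t * deriv Th t

lemma mu2_contDiff : ContDiff ℝ (⊤ : ℕ∞) mu2 := Th_contDiff.add (contDiff_id.mul Th_deriv_contDiff)

lemma mu2_zero {t : ℝ} (h : 2 < t) : mu2 t = 0 := by
  unfold mu2
  rw [Th_zero h.le, Th_deriv_zero (by simp; intro; linarith)]; simp

lemma mu2_bdd {B : ℝ} (hB : ∀ t, |deriv Th t| ≤ B) (hB0 : 0 < B) {t : ℝ} (h0 : 0 ≤ t) : |mu2 t| ≤ 1 + 2 * B := by
  by_cases h : 2 < t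
  · rw [mu2_zero h]; simp; positivity
  · push Not at h
    unfold mu2
    refine (abs_add_le _ _).trans ?_
    rw [abs_of_nonneg (Th_nonneg t), abs_mul, abs_of_nonneg h0]
    have := hB t
    have := Th_le_one t
    have := abs_nonneg (deriv Th t)
    nlinarith

lemma scaled_integrable {q : Pl} {s : ℝ} (hs : 0 < s) {m : ℝ → ℝ} (hm : ContDiff ℝ (⊤ : ℕ∞) m)
    (h0 : ∀ t, 2 < t → m t = 0) : Integrable (fun x => m (dsq q x / s)) := by
  apply supp_integrable isOpen_univ (annulus_compact q 0 (2 * s)) (subset_univ _)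
  · exact (hm.comp ((dsq_contDiff q).div_const s)).contDiffOn
  · intro x hx
    apply h0
    rw [lt_div_iff₀ hs]
    by_contra h
    exact hx ⟨dsq_nonneg q x, by linarith⟩

lemma mul_bdd_integrable {f g : Pl → ℝ} (hf : Integrable f) (hg : AEStronglyMeasurable g) {M : ℝ}
    (hM : ∀ x, |g x| ≤ M) : Integrable (fun x => f x * g x) :=
  hf.mul_bdd (c := M) hg (Eventually.of_forall hM)

lemma J1_integrable {U : Set Pl} (hU : IsOpen U) {u : Pl → ℝ} (hu : SmoothOn u U) {q : Pl} {s : ℝ} (hs : 0 < s)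
    (hKU : ∀ x, x ≠ q → dsq q x ≤ 2 * s → x ∈ U) : Integrable (J1 u q s) := by
  apply supp_integrable hU (annulus_compact q s (2 * s))
  · intro x hx
    apply hKU x _ hx.2
    rintro rfl
    have := hx.1
    simp [dsq] at this
    linarith
  · exact (((Th_deriv_contDiff.comp ((dsq_contDiff q).div_const s)).div_const s).contDiffOn).mul (Qf_smooth hU hu q)
  · intro x hx
    unfold J1
    rw [Th_deriv_zero]
    · simp
    · intro h
      exact hx ⟨by have := h.1; rwa [le_div_iff₀ hs, one_mul] at this,
        by have := h.2; rwa [div_le_iff₀ hs] at this⟩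

lemma local_identity {U : Set Pl} (hU : IsOpen U) {u : Pl → ℝ} (hu : SmoothOn u U) {G : ℝ → ℝ}
    (hG : ContDiff ℝ (⊤ : ℕ∞) G) {M : ℝ} (hM : ∀ t, |G t| ≤ M)
    (hGm : AEStronglyMeasurable (fun x => G (u x)))
    {β : ℝ} (pde : ∀ x ∈ U, lap u x = β * deriv G (u x)) {q : Pl} {a : ℝ} (hq : LogSing u q a)
    {ρ : ℝ} (hρ : 0 < ρ) (hKU : ∀ x, x ≠ q → dsq q x ≤ 2 * ρ → x ∈ U) :
    (∫ x, J1 u q ρ x) - 2 * β * (∫ x, mu2 (dsq q x / ρ) * G (u x)) = - (4 * π * a ^ 2) := by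
  obtain ⟨B, hB0, hB⟩ := Th_deriv_bdd
  have hM0 : 0 ≤ M := (abs_nonneg _).trans (hM 0)
  have I2 : ∀ s, 0 < s → Integrable (fun x => mu2 (dsq q x / s) * G (u x)) := fun s hs =>
    mul_bdd_integrable (scaled_integrable hs mu2_contDiff (fun t ht => mu2_zero ht)) hGm (fun x => hM _)
  -- the identity between two scales
  have key : ∀ s, 0 < s → s < ρ →
      (∫ x, J1 u q ρ x) - 2 * β * (∫ x, mu2 (dsq q x / ρ) * G (u x)) =
      (∫ x, J1 u q s x) - 2 * β * (∫ x, mu2 (dsq q x / s) * G (u x)) := by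
    intro s hs hsρ
    have hd : ∀ c : ℝ, ∀ t, HasDerivAt (fun t => Th (t / c)) (deriv Th (t / c) / c) t := by
      intro c t
      have := (Th_hasDeriv (t / c)).comp t ((hasDerivAt_id t).div_const c)
      have e : deriv Th (t / c) * (1 / c) = deriv Th (t / c) / c := by ring
      rw [← e]
      exact this
    have hder : ∀ t, deriv (fun t => Th (t / ρ) - Th (t / s)) t = deriv Th (t / ρ) / ρ - deriv Th (t / s) / s :=
      fun t => ((hd ρ t).sub (hd s t)).deriv
    have P := pohozaev hU hu hG pde q (k := fun t => Th (t / ρ) - Th (t / s)) (t1 := s) (t2 := 2 * ρ)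
      ((Th_contDiff.comp (contDiff_id.div_const ρ)).sub (Th_contDiff.comp (contDiff_id.div_const s)))
      (by
        intro t ht
        rw [mem_Icc, not_and_or, not_le, not_le] at ht
        rcases ht with h | h
        · rw [Th_one, Th_one, sub_self]
          · rw [div_le_one hs]; exact h.le
          · rw [div_le_one hρ]; exact (h.trans hsρ).le
        · rw [Th_zero, Th_zero, sub_self]
          · rw [le_div_iff₀ hs]; linarith
          · rw [le_div_iff₀ hρ]; linarith)
      (by
        intro x hx
        apply hKU x _ hx.2
        rintro rfl
        have := hx.1
        simp [dsq] at this
        linarith)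
    have e1 : (fun x => deriv (fun t => Th (t / ρ) - Th (t / s)) (dsq q x) * Qf u q x) =
        fun x => J1 u q ρ x - J1 u q s x := by
      funext x; rw [hder]; unfold J1; ring
    have e2 : (fun x => (Th (dsq q x / ρ) - Th (dsq q x / s) +
        dsq q x * deriv (fun t => Th (t / ρ) - Th (t / s)) (dsq q x)) * G (u x)) =
        fun x => mu2 (dsq q x / ρ) * G (u x) - mu2 (dsq q x / s) * G (u x) := by
      funext x; rw [hder]; unfold mu2; ring
    rw [e1, e2, integral_sub (J1_integrable hU hu hρ hKU)
      (J1_integrable hU hu hs (fun x h1 h2 => hKU x h1 (by linarith))),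
      integral_sub (I2 ρ hρ) (I2 s hs)] at P
    linarith
  rw [← sub_eq_zero]
  apply eq_zero_of_small (C := B * 2 * π + 2 * |β| * ((1 + 2 * B) * M * (2 * π))) (by positivity)
  intro η hη
  obtain ⟨δ, hδ, hQ⟩ := Qf_limit hq hη
  set s := min (ρ / 2) (min (δ / 4) η) with hs_def
  have hs : 0 < s := by positivity
  have hs1 : s < ρ := (min_le_left _ _).trans_lt (by linarith)
  have hs2 : s ≤ δ / 4 := (min_le_right _ _).trans (min_le_left _ _)
  have hs3 : s ≤ η := (min_le_right _ _).trans (min_le_right _ _)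
  rw [key s hs hs1]
  have hmi : Integrable (fun x => deriv Th (dsq q x / s) / s * (4 * a ^ 2)) :=
    ((scaled_integrable hs Th_deriv_contDiff (fun t ht => Th_deriv_zero (by simp; intro; linarith))).div_const s).mul_const _
  have hsplit : (∫ x, J1 u q s x) = (∫ x, deriv Th (dsq q x / s) / s * (Qf u q x - 4 * a ^ 2)) + (-π) * (4 * a ^ 2) := by
    rw [← Th_mass q hs, ← integral_mul_const, ← integral_add]
    · congr 1; funext x; unfold J1; ring
    · have := (J1_integrable hU hu hs (fun x h1 h2 => hKU x h1 (by linarith))).sub hmi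
      refine this.congr (Eventually.of_forall fun x => ?_)
      simp [J1]; ring
    · exact hmi
  have b1 : |∫ x, deriv Th (dsq q x / s) / s * (Qf u q x - 4 * a ^ 2)| ≤ (B / s * η) * (2 * s * π) := by
    apply bound_int q hs
    · intro x hx
      rw [Th_deriv_zero]
      · simp
      · intro h
        have := h.2
        rw [div_le_iff₀ hs] at this
        linarith
    · intro x hx
      by_cases hxq : x = q
      · subst hxq
        have : deriv Th (dsq x x / s) = 0 := Th_deriv_zero (by simp [dsq])
        rw [this]; simp; positivity
      · rw [abs_mul, abs_div, abs_of_pos hs]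
        have := hQ x hxq (by linarith)
        have := hB (dsq q x / s)
        gcongr
  have b2 : |∫ x, mu2 (dsq q x / s) * G (u x)| ≤ ((1 + 2 * B) * M) * (2 * s * π) := by
    apply bound_int q hs
    · intro x hx
      rw [mu2_zero, zero_mul]
      rwa [lt_div_iff₀ hs]
    · intro x hx
      rw [abs_mul]
      have := hM (u x)
      have := mu2_bdd hB hB0 (t := dsq q x / s) (div_nonneg (dsq_nonneg _ _) hs.le)
      gcongr
  rw [hsplit]
  generalize (∫ x, deriv Th (dsq q x / s) / s * (Qf u q x - 4 * a ^ 2)) = A at *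
  generalize (∫ x, mu2 (dsq q x / s) * G (u x)) = A2 at *
  have e : A + -π * (4 * a ^ 2) - 2 * β * A2 - -(4 * π * a ^ 2) = A - 2 * β * A2 := by ring
  rw [e]
  refine (abs_sub _ _).trans ?_
  rw [abs_mul, abs_mul, abs_two]
  have e1 : (B / s * η) * (2 * s * π) = B * 2 * π * η := by field_simp
  rw [e1] at b1
  have b3 : ((1 + 2 * B) * M) * (2 * s * π) ≤ (1 + 2 * B) * M * (2 * π) * η := by
    have : 0 ≤ (1 + 2 * B) * M * (2 * π) := by positivity
    nlinarith
  have b4 := mul_le_mul_of_nonneg_left (b2.trans b3) (by positivity : 0 ≤ 2 * |β|)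
  linarith


/-- The energy density `(1-e^t)^2/(τ+e^t)^2`. -/
def Gf (τ t : ℝ) : ℝ := (1 - exp t) ^ 2 / (τ + exp t) ^ 2

lemma Gf_contDiff {τ : ℝ} (hτ : 0 < τ) : ContDiff ℝ (⊤ : ℕ∞) (Gf τ) :=
  ((contDiff_const.sub Real.contDiff_exp).pow 2).div ((contDiff_const.add Real.contDiff_exp).pow 2)
    (fun t => by have := Real.exp_pos t; positivity)

lemma Gf_nonneg (τ t : ℝ) : 0 ≤ Gf τ t := by unfold Gf; positivity

lemma Gf_bdd {τ : ℝ} (hτ : 0 < τ) (t : ℝ) : |Gf τ t| ≤ (1 + 1 / τ) ^ 2 := by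
  rw [abs_of_nonneg (Gf_nonneg τ t)]
  unfold Gf
  have he := Real.exp_pos t
  rw [← div_pow, ← sq_abs]
  gcongr
  rw [abs_div, abs_of_pos (by positivity : 0 < τ + exp t), div_le_iff₀ (by positivity)]
  have : (1 + 1 / τ) * (τ + exp t) = τ + exp t + 1 + exp t / τ := by field_simp; ring
  rw [this, abs_le]
  have : 0 < exp t / τ := by positivity
  constructor <;> linarith

lemma Gf_deriv {τ : ℝ} (hτ : 0 < τ) (t : ℝ) : deriv (Gf τ) t = - (2 * (τ + 1) * fτ τ t) := by
  have he := Real.exp_pos t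
  have h1 := ((Real.hasDerivAt_exp t).const_sub 1).pow 2
  have h2 := ((Real.hasDerivAt_exp t).const_add τ).pow 2
  have h := h1.div h2 (by simp only [Pi.pow_apply]; positivity)
  have e : deriv (Gf τ) t = _ := h.deriv
  rw [e]
  unfold fτ
  simp only [Pi.pow_apply]
  have : τ + exp t ≠ 0 := by positivity
  field_simp
  push_cast
  ring

lemma Gf_small {τ : ℝ} (hτ : 0 < τ) {t : ℝ} (ht : |t| ≤ 1) : Gf τ t ≤ 4 / τ ^ 2 * t ^ 2 := by
  unfold Gf
  have he := Real.exp_pos t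
  have h1 : (1 - exp t) ^ 2 ≤ 4 * t ^ 2 := by
    have := Real.abs_exp_sub_one_le ht
    rw [← sq_abs, abs_sub_comm, ← sq_abs t]
    have := abs_nonneg (exp t - 1)
    nlinarith
  calc (1 - exp t) ^ 2 / (τ + exp t) ^ 2 ≤ 4 * t ^ 2 / τ ^ 2 := by
        gcongr; linarith
    _ = _ := by ring

/-! ### Measurability -/

lemma unitLattice_countable : unitLattice.Countable := by
  have : unitLattice = range (fun z : ℤ × ℤ => ((z.1 : ℝ) • EuclideanSpace.single 0 (1:ℝ) +
      (z.2 : ℝ) • EuclideanSpace.single 1 (1:ℝ) : Pl)) := by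
    ext x; constructor
    · rintro ⟨a, b, rfl⟩; exact ⟨(a, b), rfl⟩
    · rintro ⟨⟨a, b⟩, rfl⟩; exact ⟨a, b, rfl⟩
  rw [this]; exact countable_range _

lemma Z_countable (V : VortexData) : V.Z.Countable := by
  have aux : ∀ {d : ℕ} (p : Fin d → Pl), {x | ∃ j v, v ∈ unitLattice ∧ x = p j + v}.Countable := by
    intro d p
    have : {x | ∃ j v, v ∈ unitLattice ∧ x = p j + v} = ⋃ j, (fun v => p j + v) '' unitLattice := by
      ext x; simp only [mem_setOf_eq, mem_iUnion, mem_image]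
      constructor
      · rintro ⟨j, v, hv, rfl⟩; exact ⟨j, v, hv, rfl⟩
      · rintro ⟨j, v, hv, rfl⟩; exact ⟨j, v, hv, rfl⟩
    rw [this]
    exact countable_iUnion (fun j => unitLattice_countable.image _)
  exact (aux V.p₁).union (aux V.p₂)

lemma Z_null (V : VortexData) : volume V.Z = 0 := (Z_countable V).measure_zero _

lemma sol_measurable {V : VortexData} {τ e : ℝ} {u : Pl → ℝ} (hu : IsSolution V τ e u) :
    AEStronglyMeasurable u := by
  have h := (hu.smooth.continuousOn).aestronglyMeasurable (μ := volume) (isOpen_compl_Z V).measurableSet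
  rwa [Measure.restrict_eq_self_of_ae_mem] at h
  have := Z_null V
  rw [← compl_compl V.Z] at this
  exact this

lemma Gsol_measurable {V : VortexData} {τ e : ℝ} {u : Pl → ℝ} (hτ : 0 < τ) (hu : IsSolution V τ e u) :
    AEStronglyMeasurable (fun x => Gf τ (u x)) :=
  (Gf_contDiff hτ).continuous.comp_aestronglyMeasurable (sol_measurable hu)

lemma LogSing.translate {u : Pl → ℝ} {p w : Pl} {a : ℝ} (h : LogSing u p a) (hp : Periodic2 u)
    (hw : w ∈ unitLattice) : LogSing u (p + w) a := by
  obtain ⟨r, hr, v, hv, huv⟩ := h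
  have hm : ∀ x ∈ ball (p + w) r, x - w ∈ ball p r := by
    intro x hx
    rw [mem_ball, dist_eq_norm] at hx ⊢
    rwa [show x - w - p = x - (p + w) by abel]
  refine ⟨r, hr, fun x => v (x - w), ?_, ?_⟩
  · exact hv.comp (contDiffOn_id.sub contDiffOn_const) hm
  · intro x hx hxp
    have h1 := huv (x - w) (hm x hx) (fun h => hxp (by rw [← h]; abel))
    have h2 := hp (x - w) w hw
    rw [sub_add_cancel] at h2
    rw [h2, h1, show x - w - p = x - (p + w) by abel]

lemma negl_int {K : Set Pl} (hK : IsCompact K) {ε : ℕ → ℝ} (hε0 : Tendsto ε atTop (nhds 0)) {F : ℕ → Pl → ℝ}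
    (h0 : ∀ k, ∀ x ∉ K, F k x = 0) {C : ℝ} (hb : ∀ᶠ k in atTop, ∀ x ∈ K, |F k x| ≤ C * ε k) :
    Tendsto (fun k => ∫ x, F k x) atTop (nhds 0) := by
  have hlim : Tendsto (fun k => C * ε k * (volume : Measure Pl).real K) atTop (nhds 0) := by
    simpa using (hε0.const_mul C).mul_const ((volume : Measure Pl).real K)
  apply squeeze_zero_norm' _ hlim
  filter_upwards [hb] with k hk
  rw [← setIntegral_eq_integral_of_forall_compl_eq_zero (s := K) (h0 k)]
  exact norm_setIntegral_le_of_norm_le_const hK.measure_lt_top (fun x hx => hk x hx)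

section decay2

variable {V : VortexData} {τ : ℝ} {ε : ℕ → ℝ} {u : ℕ → Pl → ℝ}

lemma pd_negl (hτ : 0 < τ) (hε : ∀ n, 0 < ε n) (hε0 : Tendsto ε atTop (nhds 0))
    (hu : ∀ n, IsSolution V τ (ε n) (u n))
    (htop : ∀ K : Set Pl, IsCompact K → K ⊆ (V.Z)ᶜ →
        TendstoUniformlyOn u (fun _ => (0:ℝ)) atTop K) (i : Fin 2) :
    Negl ε (V.Z)ᶜ (fun k => pd (u k) i) :=
  negl_pd hε (isOpen_compl_Z V) (fun k => (hu k).smooth) (u_negl hτ hε hε0 hu htop)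
    (negD_zero.1 (lap_negD hτ hε hε0 hu htop 0 (fun i _ => all_negD hτ hε hε0 hu htop i))) i

lemma density_negl (hτ : 0 < τ) (hε : ∀ n, 0 < ε n) (hε0 : Tendsto ε atTop (nhds 0))
    (hu : ∀ n, IsSolution V τ (ε n) (u n))
    (htop : ∀ K : Set Pl, IsCompact K → K ⊆ (V.Z)ᶜ →
        TendstoUniformlyOn u (fun _ => (0:ℝ)) atTop K) {K : Set Pl} (hK : IsCompact K) (hKU : K ⊆ (V.Z)ᶜ) :
    ∃ C > 0, ∀ᶠ k in atTop, ∀ x ∈ K, ((ε k) ^ 2)⁻¹ * Gf τ (u k x) ≤ C * ε k := by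
  obtain ⟨C, hC, hb⟩ := u_negl hτ hε hε0 hu htop K hK hKU 2
  refine ⟨4 / τ ^ 2 * C ^ 2, by positivity, ?_⟩
  filter_upwards [hb, u_small htop hK hKU one_pos, eps_le_one hε0 one_pos] with k hk h1 he x hx
  have hεk := hε k
  rw [inv_mul_le_iff₀ (by positivity)]
  refine (Gf_small hτ (h1 x hx)).trans ?_
  have h2 : (u k x) ^ 2 ≤ (C * ε k ^ 2) ^ 2 := by
    rw [← sq_abs]; exact pow_le_pow_left₀ (abs_nonneg _) (hk x hx) 2
  calc 4 / τ ^ 2 * (u k x) ^ 2 ≤ 4 / τ ^ 2 * (C * ε k ^ 2) ^ 2 := by gcongr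
    _ = 4 / τ ^ 2 * C ^ 2 * (ε k ^ 3 * ε k) := by ring
    _ ≤ 4 / τ ^ 2 * C ^ 2 * (ε k ^ 3 * 1) := by gcongr
    _ = _ := by ring

lemma Qf_bound (v : Pl → ℝ) (q x : Pl) : |Qf v q x| ≤ dsq q x * ((pd v 0 x) ^ 2 + (pd v 1 x) ^ 2) := by
  unfold Qf dsq
  generalize pd v 0 x = A
  generalize pd v 1 x = B
  generalize x 0 - q 0 = X
  generalize x 1 - q 1 = Y
  rw [abs_le]
  constructor
  · nlinarith [_root_.sq_nonneg (X * A + Y * B)]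
  · nlinarith [_root_.sq_nonneg (X * B - Y * A)]

lemma local_limit (hτ : 0 < τ) (hε : ∀ n, 0 < ε n) (hε0 : Tendsto ε atTop (nhds 0))
    (hu : ∀ n, IsSolution V τ (ε n) (u n))
    (htop : ∀ K : Set Pl, IsCompact K → K ⊆ (V.Z)ᶜ →
        TendstoUniformlyOn u (fun _ => (0:ℝ)) atTop K) {q : Pl} {a : ℝ} (hq : ∀ n, LogSing (u n) q a)
    {ρ : ℝ} (hρ : 0 < ρ) (hKU : ∀ x, x ≠ q → dsq q x ≤ 2 * ρ → x ∈ (V.Z)ᶜ) :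
    Tendsto (fun k => ∫ x, Th (dsq q x / ρ) * (((ε k) ^ 2)⁻¹ * Gf τ (u k x))) atTop
      (nhds (4 * (τ + 1) * π * a ^ 2)) := by
  have hU := isOpen_compl_Z V
  obtain ⟨B, hB0, hB⟩ := Th_deriv_bdd
  have hK := annulus_compact q ρ (2 * ρ)
  have hKsub : {x : Pl | dsq q x ∈ Icc ρ (2 * ρ)} ⊆ (V.Z)ᶜ := by
    intro x hx
    apply hKU x _ hx.2
    rintro rfl
    have := hx.1
    simp [dsq] at this
    linarith
  have hoff : ∀ x ∉ {x : Pl | dsq q x ∈ Icc ρ (2 * ρ)}, deriv Th (dsq q x / ρ) = 0 := by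
    intro x hx
    apply Th_deriv_zero
    intro h
    exact hx ⟨by have := h.1; rwa [le_div_iff₀ hρ, one_mul] at this,
        by have := h.2; rwa [div_le_iff₀ hρ] at this⟩
  set F : ℕ → Pl → ℝ := fun k x => (τ + 1) * J1 (u k) q ρ x -
    (dsq q x / ρ * deriv Th (dsq q x / ρ)) * (((ε k) ^ 2)⁻¹ * Gf τ (u k x)) with hF
  obtain ⟨C, hC, hb⟩ := density_negl hτ hε hε0 hu htop hK hKsub
  obtain ⟨C0, hC0, hb0⟩ := pd_negl hτ hε hε0 hu htop 0 _ hK hKsub 1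
  obtain ⟨C1, hC1, hb1⟩ := pd_negl hτ hε hε0 hu htop 1 _ hK hKsub 1
  have hFlim : Tendsto (fun k => ∫ x, F k x) atTop (nhds 0) := by
    refine negl_int hK hε0 (C := (τ + 1) * (2 * B * (C0 ^ 2 + C1 ^ 2)) + 2 * B * C) ?_ ?_
    · intro k x hx
      simp [hF, J1, hoff x hx]
    · filter_upwards [hb, hb0, hb1, eps_le_one hε0 one_pos] with k hk hk0 hk1 he x hx
      have hεk := hε k
      have hd := hx.2
      have hBx := hB (dsq q x / ρ)
      have hdn := dsq_nonneg q x
      have j1 : |J1 (u k) q ρ x| ≤ 2 * B * (C0 ^ 2 + C1 ^ 2) * ε k := by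
        unfold J1
        rw [abs_mul, abs_div, abs_of_pos hρ]
        have hQ := Qf_bound (u k) q x
        have a0 : (pd (u k) 0 x) ^ 2 ≤ (C0 * ε k ^ 1) ^ 2 := by
          rw [← sq_abs]; exact pow_le_pow_left₀ (abs_nonneg _) (hk0 x hx) 2
        have a1 : (pd (u k) 1 x) ^ 2 ≤ (C1 * ε k ^ 1) ^ 2 := by
          rw [← sq_abs]; exact pow_le_pow_left₀ (abs_nonneg _) (hk1 x hx) 2
        calc |deriv Th (dsq q x / ρ)| / ρ * |Qf (u k) q x|
            ≤ B / ρ * (2 * ρ * ((C0 * ε k ^ 1) ^ 2 + (C1 * ε k ^ 1) ^ 2)) := by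
              gcongr
              exact hQ.trans (by gcongr)
          _ = 2 * B * (C0 ^ 2 + C1 ^ 2) * (ε k * ε k) := by field_simp
          _ ≤ 2 * B * (C0 ^ 2 + C1 ^ 2) * (ε k * 1) := by gcongr
          _ = _ := by ring
      have hgn : 0 ≤ ((ε k) ^ 2)⁻¹ * Gf τ (u k x) := mul_nonneg (by positivity) (Gf_nonneg _ _)
      have j2 : |(dsq q x / ρ * deriv Th (dsq q x / ρ)) * (((ε k) ^ 2)⁻¹ * Gf τ (u k x))| ≤ 2 * B * C * ε k := by
        rw [abs_mul, abs_mul, abs_of_nonneg hgn, abs_of_nonneg (by positivity : 0 ≤ dsq q x / ρ)]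
        have h2 : dsq q x / ρ ≤ 2 := by rwa [div_le_iff₀ hρ]
        have := hk x hx
        calc dsq q x / ρ * |deriv Th (dsq q x / ρ)| * (((ε k) ^ 2)⁻¹ * Gf τ (u k x))
            ≤ 2 * B * (C * ε k) := by gcongr
          _ = _ := by ring
      simp only [hF]
      refine (abs_sub _ _).trans ?_
      rw [abs_mul, abs_of_pos (by positivity : 0 < τ + 1)]
      have := mul_le_mul_of_nonneg_left j1 (by positivity : 0 ≤ τ + 1)
      linarith
  have hid : ∀ k, ∫ x, Th (dsq q x / ρ) * (((ε k) ^ 2)⁻¹ * Gf τ (u k x)) =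
      4 * (τ + 1) * π * a ^ 2 + ∫ x, F k x := by
    intro k
    have hεk := hε k
    have hm := Gsol_measurable hτ (hu k)
    have L := local_identity hU (hu k).smooth (Gf_contDiff hτ) (Gf_bdd hτ) hm
      (β := ((ε k) ^ 2)⁻¹ / (2 * (τ + 1)))
      (by
        intro x hx
        have := (hu k).pde x hx
        rw [Gf_deriv hτ]
        have e : ((ε k) ^ 2)⁻¹ / (2 * (τ + 1)) * -(2 * (τ + 1) * fτ τ (u k x)) = - (((ε k) ^ 2)⁻¹ * fτ τ (u k x)) := by
          field_simp
        rw [e]; linarith) (hq k) hρ hKU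
    have iJ := J1_integrable hU (hu k).smooth hρ hKU
    have i1 : Integrable (fun x => mu2 (dsq q x / ρ) * Gf τ (u k x)) :=
      mul_bdd_integrable (scaled_integrable hρ mu2_contDiff (fun t ht => mu2_zero ht)) hm (fun x => Gf_bdd hτ _)
    have i2 : Integrable (fun x => Th (dsq q x / ρ) * Gf τ (u k x)) :=
      mul_bdd_integrable (scaled_integrable hρ Th_contDiff (fun t ht => Th_zero ht.le)) hm (fun x => Gf_bdd hτ _)
    have e1 : F k = fun x => ((τ + 1) * J1 (u k) q ρ x - ((ε k) ^ 2)⁻¹ * (mu2 (dsq q x / ρ) * Gf τ (u k x)))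
        + ((ε k) ^ 2)⁻¹ * (Th (dsq q x / ρ) * Gf τ (u k x)) := by
      funext x; simp only [hF]; unfold mu2; ring
    have e2 : (fun x => Th (dsq q x / ρ) * (((ε k) ^ 2)⁻¹ * Gf τ (u k x))) =
        fun x => ((ε k) ^ 2)⁻¹ * (Th (dsq q x / ρ) * Gf τ (u k x)) := by
      funext x; ring
    have i3 : Integrable (fun x => (τ + 1) * J1 (u k) q ρ x - ((ε k) ^ 2)⁻¹ * (mu2 (dsq q x / ρ) * Gf τ (u k x))) :=
      (iJ.const_mul _).sub (i1.const_mul _)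
    rw [e1, e2, integral_add i3 (i2.const_mul _),
      integral_sub (iJ.const_mul _) (i1.const_mul _), integral_const_mul, integral_const_mul, integral_const_mul]
    have e3 : (τ + 1) * (2 * (((ε k) ^ 2)⁻¹ / (2 * (τ + 1)))) = ((ε k) ^ 2)⁻¹ := by
      have : τ + 1 ≠ 0 := by positivity
      field_simp
    have := congrArg (fun z => (τ + 1) * z) L
    simp only [mul_sub, ← mul_assoc] at this
    rw [← mul_assoc] at e3
    rw [e3] at this
    linarith
  simp_rw [hid]
  simpa using hFlim.const_add (4 * (τ + 1) * π * a ^ 2)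

end decay2


lemma assemble {ι : Type} [Fintype ι] {q : ι → Pl} (hinj : Function.Injective q) {D Box : Set Pl}
    (hDm : MeasurableSet D) (hO : ∀ j, D ∈ 𝓝 (q j)) (hDB : D ⊆ Box) (hBox : IsCompact Box)
    {ε : ℕ → ℝ} (hε0 : Tendsto ε atTop (nhds 0))
    {g : ℕ → Pl → ℝ} (hg0 : ∀ k x, 0 ≤ g k x) (gm : ∀ k, AEStronglyMeasurable (g k))
    (gbd : ∀ k, ∃ M, ∀ x, |g k x| ≤ M) {A : ι → ℝ}
    (hloc : ∃ ρ0 > 0, ∀ ρ, 0 < ρ → ρ < ρ0 → ∀ j,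
      Tendsto (fun k => ∫ x, Th (dsq (q j) x / ρ) * g k x) atTop (nhds (A j)))
    (hfar : ∀ K : Set Pl, IsCompact K → K ⊆ Box → (∀ j, q j ∉ K) → ∃ C, ∀ᶠ k in atTop, ∀ x ∈ K, g k x ≤ C * ε k)
    {φ : Pl → ℝ} (hφ : Continuous φ) :
    Tendsto (fun k => ∫ x in D, g k x * φ x) atTop (nhds (∑ j, A j * φ (q j))) := by
  classical
  obtain ⟨ρ0, hρ0, hloc⟩ := hloc
  obtain ⟨M0, hM0⟩ := hBox.exists_bound_of_continuousOn hφ.continuousOn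
  rw [Metric.tendsto_nhds]
  intro e he
  set η : ℝ := e / (2 * (|∑ j, A j| + 1)) with hη_def
  have hη : 0 < η := by positivity
  -- choice of the radius
  have ev1 : ∀ᶠ r in 𝓝[>] (0:ℝ), ∀ j, closedBall (q j) r ⊆ D ∩ {x | |φ x - φ (q j)| < η} := by
    rw [eventually_all]
    intro j
    refine Filter.Eventually.filter_mono nhdsWithin_le_nhds (eventually_closedBall_subset ?_)
    refine inter_mem (hO j) ?_
    have : IsOpen {x | |φ x - φ (q j)| < η} :=
      isOpen_lt ((hφ.sub continuous_const).abs) continuous_const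
    exact this.mem_nhds (by simpa using hη)
  have ev2 : ∀ᶠ r in 𝓝[>] (0:ℝ), ∀ i j, i ≠ j → 2 * r < dist (q i) (q j) := by
    rw [eventually_all]; intro i
    rw [eventually_all]; intro j
    by_cases hij : i = j
    · exact Eventually.of_forall (fun r h => absurd hij h)
    · have hd : 0 < dist (q i) (q j) := dist_pos.2 (fun h => hij (hinj h))
      have : ∀ᶠ r in 𝓝 (0:ℝ), r < dist (q i) (q j) / 2 := Iio_mem_nhds (by positivity)
      filter_upwards [this.filter_mono nhdsWithin_le_nhds] with r hr _
      linarith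
  have ev3 : ∀ᶠ r in 𝓝[>] (0:ℝ), r ^ 2 / 2 < ρ0 := by
    have : ContinuousAt (fun r : ℝ => r ^ 2 / 2) 0 := by fun_prop
    have h := this.eventually (Iio_mem_nhds (by simpa using hρ0 : (0:ℝ) ^ 2 / 2 < ρ0))
    exact h.filter_mono nhdsWithin_le_nhds
  obtain ⟨r, ⟨⟨h1, h2⟩, h3⟩, hr⟩ := (((ev1.and ev2).and ev3).and self_mem_nhdsWithin).exists
  replace hr : 0 < r := hr
  set ρ := r ^ 2 / 2 with hρ_def
  have hρ : 0 < ρ := by positivity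
  have hdist : ∀ j x, dsq (q j) x ≤ 2 * ρ → dist x (q j) ≤ r := by
    intro j x h
    rw [dsq_eq, hρ_def, ← dist_eq_norm] at h
    have : dist x (q j) ^ 2 ≤ r ^ 2 := by linarith
    exact (sq_le_sq₀ dist_nonneg hr.le).1 this
  have hTh0 : ∀ j x, 2 * ρ ≤ dsq (q j) x → Th (dsq (q j) x / ρ) = 0 := fun j x h =>
    Th_zero (by rwa [le_div_iff₀ hρ])
  set K : Set Pl := Box ∩ ⋂ j, {x | ρ ≤ dsq (q j) x} with hK_def
  have hK : IsCompact K := hBox.inter_right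
    (isClosed_iInter fun j => isClosed_le continuous_const (dsq_contDiff (q j)).continuous)
  obtain ⟨C, hC⟩ := hfar K hK inter_subset_left (fun j hj => by
    have := mem_iInter.1 hj.2 j
    simp [dsq] at this
    linarith)
  set M' := |M0| + ∑ j, |φ (q j)| with hM'
  have hM'0 : 0 ≤ M' := by positivity
  -- integrability
  have iTh : ∀ k j, Integrable (fun x => Th (dsq (q j) x / ρ) * g k x) := by
    intro k j
    obtain ⟨M, hM⟩ := gbd k
    exact mul_bdd_integrable (scaled_integrable hρ Th_contDiff (fun t ht => Th_zero ht.le)) (gm k) hM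
  have iK : ∀ k, Integrable (fun x => K.indicator (fun _ => (1:ℝ)) x * g k x) := by
    intro k
    obtain ⟨M, hM⟩ := gbd k
    exact mul_bdd_integrable ((integrable_indicator_iff hK.measurableSet).2
      (integrableOn_const hK.measure_lt_top.ne)) (gm k) hM
  have iD : ∀ k, Integrable (fun x => D.indicator φ x * g k x) := by
    intro k
    obtain ⟨M, hM⟩ := gbd k
    exact mul_bdd_integrable ((integrable_indicator_iff hDm).2
      ((hφ.continuousOn.integrableOn_compact hBox).mono_set hDB)) (gm k) hM
  -- limits
  have lim1 : Tendsto (fun k => ∑ j, φ (q j) * ∫ x, Th (dsq (q j) x / ρ) * g k x) atTop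
      (nhds (∑ j, φ (q j) * A j)) :=
    tendsto_finset_sum _ (fun j _ => (hloc ρ hρ h3 j).const_mul _)
  have lim2 : Tendsto (fun k => ∑ j, ∫ x, Th (dsq (q j) x / ρ) * g k x) atTop (nhds (∑ j, A j)) :=
    tendsto_finset_sum _ (fun j _ => hloc ρ hρ h3 j)
  have lim3 : Tendsto (fun k => ∫ x, K.indicator (fun _ => (1:ℝ)) x * g k x) atTop (nhds 0) := by
    refine negl_int hK hε0 (C := C) (fun k x hx => by simp [hx]) ?_
    filter_upwards [hC] with k hk x hx
    simp only [indicator_of_mem hx, one_mul]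
    rw [abs_of_nonneg (hg0 k x)]
    exact hk x hx
  have est : ∀ k, |(∫ x in D, g k x * φ x) - ∑ j, φ (q j) * ∫ x, Th (dsq (q j) x / ρ) * g k x| ≤
      η * (∑ j, ∫ x, Th (dsq (q j) x / ρ) * g k x) + M' * ∫ x, K.indicator (fun _ => (1:ℝ)) x * g k x := by
    intro k
    have e1 : (∫ x in D, g k x * φ x) = ∫ x, D.indicator φ x * g k x := by
      rw [← integral_indicator hDm]
      congr 1; funext x
      by_cases hx : x ∈ D <;> simp [hx, mul_comm]
    have e2 : (∑ j, φ (q j) * ∫ x, Th (dsq (q j) x / ρ) * g k x) =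
        ∫ x, ∑ j, φ (q j) * (Th (dsq (q j) x / ρ) * g k x) := by
      rw [integral_finset_sum _ (fun j _ => (iTh k j).const_mul _)]
      simp_rw [integral_const_mul]
    have e3 : η * (∑ j, ∫ x, Th (dsq (q j) x / ρ) * g k x) + M' * ∫ x, K.indicator (fun _ => (1:ℝ)) x * g k x
        = ∫ x, (η * (∑ j, Th (dsq (q j) x / ρ) * g k x) + M' * (K.indicator (fun _ => (1:ℝ)) x * g k x)) := by
      rw [integral_add ((integrable_finset_sum _ (fun j _ => iTh k j)).const_mul _) ((iK k).const_mul _),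
        integral_const_mul, integral_const_mul, integral_finset_sum _ (fun j _ => iTh k j)]
    rw [e1, e2, e3, ← integral_sub (iD k) (integrable_finset_sum _ (fun j _ => (iTh k j).const_mul _)),
      ← Real.norm_eq_abs]
    apply norm_integral_le_of_norm_le
    · exact ((integrable_finset_sum _ (fun j _ => iTh k j)).const_mul _).add ((iK k).const_mul _)
    · refine Eventually.of_forall (fun x => ?_)
      have f1 : D.indicator φ x * g k x - ∑ j, φ (q j) * (Th (dsq (q j) x / ρ) * g k x) =
          (D.indicator φ x - ∑ j, φ (q j) * Th (dsq (q j) x / ρ)) * g k x := by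
        rw [sub_mul, Finset.sum_mul]; simp only [mul_assoc]
      have f2 : η * (∑ j, Th (dsq (q j) x / ρ) * g k x) + M' * (K.indicator (fun _ => (1:ℝ)) x * g k x) =
          (η * (∑ j, Th (dsq (q j) x / ρ)) + M' * K.indicator (fun _ => (1:ℝ)) x) * g k x := by
        rw [← Finset.sum_mul]; ring
      rw [f1, f2, Real.norm_eq_abs, abs_mul, abs_of_nonneg (hg0 k x)]
      apply mul_le_mul_of_nonneg_right _ (hg0 k x)
      have hind0 : 0 ≤ K.indicator (fun _ => (1:ℝ)) x := indicator_nonneg (fun _ _ => zero_le_one) x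
      have hsum0 : 0 ≤ ∑ j, Th (dsq (q j) x / ρ) := Finset.sum_nonneg (fun j _ => Th_nonneg _)
      by_cases hxD : x ∈ D
      · rw [indicator_of_mem hxD]
        by_cases hi : ∃ i, dsq (q i) x < ρ
        · obtain ⟨i, hi⟩ := hi
          have hxi := hdist i x (by linarith)
          have hz : ∀ j, j ≠ i → Th (dsq (q j) x / ρ) = 0 := by
            intro j hj
            apply hTh0
            by_contra hcon
            push Not at hcon
            have hxj := hdist j x hcon.le
            have := h2 j i hj
            have := dist_triangle_left (q j) (q i) x
            linarith
          have ho : Th (dsq (q i) x / ρ) = 1 := Th_one (by rw [div_le_one hρ]; exact hi.le)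
          rw [Finset.sum_eq_single i (fun j _ hj => by rw [hz j hj, mul_zero]) (by simp),
            Finset.sum_eq_single i (fun j _ hj => hz j hj) (by simp), ho, mul_one, mul_one]
          have := (h1 i (mem_closedBall.2 hxi)).2
          simp only [mem_setOf_eq] at this
          have := mul_nonneg hM'0 hind0
          linarith
        · push Not at hi
          have hxK : x ∈ K := ⟨hDB hxD, mem_iInter.2 hi⟩
          rw [indicator_of_mem hxK, mul_one]
          have b1 : |φ x| ≤ |M0| := (hM0 x (hDB hxD)).trans (le_abs_self _)
          have b2 : |∑ j, φ (q j) * Th (dsq (q j) x / ρ)| ≤ ∑ j, |φ (q j)| := by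
            refine (Finset.abs_sum_le_sum_abs _ _).trans (Finset.sum_le_sum fun j _ => ?_)
            rw [abs_mul, abs_of_nonneg (Th_nonneg _)]
            exact mul_le_of_le_one_right (abs_nonneg _) (Th_le_one _)
          have := abs_sub (φ x) (∑ j, φ (q j) * Th (dsq (q j) x / ρ))
          have := mul_nonneg hη.le hsum0
          linarith
      · rw [indicator_of_notMem hxD]
        have hz : ∀ j, Th (dsq (q j) x / ρ) = 0 := by
          intro j
          apply hTh0
          by_contra hcon
          push Not at hcon
          exact hxD (h1 j (mem_closedBall.2 (hdist j x hcon.le))).1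
        simp only [hz]
        simp only [mul_zero, Finset.sum_const_zero, sub_zero, abs_zero, zero_add]
        positivity
  have e4 : (∑ j, A j * φ (q j)) = ∑ j, φ (q j) * A j := Finset.sum_congr rfl (fun j _ => mul_comm _ _)
  have lim4 : Tendsto (fun k => |(∑ j, φ (q j) * ∫ x, Th (dsq (q j) x / ρ) * g k x) - ∑ j, φ (q j) * A j| +
      (η * (∑ j, ∫ x, Th (dsq (q j) x / ρ) * g k x) + M' * ∫ x, K.indicator (fun _ => (1:ℝ)) x * g k x))
      atTop (nhds (|(∑ j, φ (q j) * A j) - ∑ j, φ (q j) * A j| + (η * (∑ j, A j) + M' * 0))) :=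
    ((lim1.sub_const _).abs).add ((lim2.const_mul η).add (lim3.const_mul M'))
  have hlt : |(∑ j, φ (q j) * A j) - ∑ j, φ (q j) * A j| + (η * (∑ j, A j) + M' * 0) < e := by
    rw [sub_self, abs_zero, mul_zero, zero_add, add_zero]
    have : η * (∑ j, A j) ≤ η * (|∑ j, A j| + 1) := by
      apply mul_le_mul_of_nonneg_left _ hη.le
      have := le_abs_self (∑ j, A j)
      linarith
    have h : η * (|∑ j, A j| + 1) = e / 2 := by rw [hη_def]; field_simp
    linarith
  filter_upwards [lim4.eventually (gt_mem_nhds hlt)] with k hk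
  rw [e4, Real.dist_eq]
  refine lt_of_le_of_lt ?_ hk
  have := est k
  have h5 := abs_add_le ((∫ x in D, g k x * φ x) - ∑ j, φ (q j) * ∫ x, Th (dsq (q j) x / ρ) * g k x)
    ((∑ j, φ (q j) * ∫ x, Th (dsq (q j) x / ρ) * g k x) - ∑ j, φ (q j) * A j)
  rw [sub_add_sub_cancel] at h5
  linarith


lemma mem_unitLattice {v : Pl} : v ∈ unitLattice ↔ ∃ a b : ℤ, v 0 = a ∧ v 1 = b := by
  constructor
  · rintro ⟨a, b, rfl⟩
    exact ⟨a, b, by simp, by simp⟩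
  · rintro ⟨a, b, h0, h1⟩
    refine ⟨a, b, ?_⟩
    ext i
    fin_cases i
    · simpa using h0
    · simpa using h1

/-- The lattice as an additive subgroup. -/
def latGrp : AddSubgroup Pl where
  carrier := unitLattice
  zero_mem' := mem_unitLattice.2 ⟨0, 0, by simp, by simp⟩
  add_mem' := by
    intro v w hv hw
    obtain ⟨a, b, h0, h1⟩ := mem_unitLattice.1 hv
    obtain ⟨a', b', h0', h1'⟩ := mem_unitLattice.1 hw
    exact mem_unitLattice.2 ⟨a + a', b + b', by simp [h0, h0'], by simp [h1, h1']⟩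
  neg_mem' := by
    intro v hv
    obtain ⟨a, b, h0, h1⟩ := mem_unitLattice.1 hv
    exact mem_unitLattice.2 ⟨-a, -b, by simp [h0], by simp [h1]⟩

/-- Half-open unit box with corner `c`. -/
def boxc (c0 c1 : ℝ) : Set Pl := {x | x 0 ∈ Ico c0 (c0 + 1) ∧ x 1 ∈ Ico c1 (c1 + 1)}

lemma boxc_measurable (c0 c1 : ℝ) : MeasurableSet (boxc c0 c1) := by
  have h0 : Measurable (fun x : Pl => x 0) := (by fun_prop : Continuous (fun x : Pl => x 0)).measurable
  have h1 : Measurable (fun x : Pl => x 1) := (by fun_prop : Continuous (fun x : Pl => x 1)).measurable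
  exact (h0 measurableSet_Ico).inter (h1 measurableSet_Ico)

lemma boxc_cover (c0 c1 : ℝ) (x : Pl) : ∃! w : latGrp, w +ᵥ x ∈ boxc c0 c1 := by
  obtain ⟨a, ha, ha'⟩ := existsUnique_add_zsmul_mem_Ico (zero_lt_one (α := ℝ)) (x 0) c0
  obtain ⟨b, hb, hb'⟩ := existsUnique_add_zsmul_mem_Ico (zero_lt_one (α := ℝ)) (x 1) c1
  have hw : (a : ℝ) • EuclideanSpace.single 0 (1:ℝ) + (b : ℝ) • EuclideanSpace.single 1 (1:ℝ) ∈ unitLattice :=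
    ⟨a, b, rfl⟩
  refine ⟨⟨_, hw⟩, ?_, ?_⟩
  · constructor
    · have : ((a : ℝ) • EuclideanSpace.single 0 (1:ℝ) + (b : ℝ) • EuclideanSpace.single 1 (1:ℝ) + x : Pl) 0 = x 0 + a • (1:ℝ) := by
        simp [add_comm]
      change ((a : ℝ) • EuclideanSpace.single 0 (1:ℝ) + (b : ℝ) • EuclideanSpace.single 1 (1:ℝ) + x : Pl) 0 ∈ _
      rw [this]; exact ha
    · have : ((a : ℝ) • EuclideanSpace.single 0 (1:ℝ) + (b : ℝ) • EuclideanSpace.single 1 (1:ℝ) + x : Pl) 1 = x 1 + b • (1:ℝ) := by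
        simp [add_comm]
      change ((a : ℝ) • EuclideanSpace.single 0 (1:ℝ) + (b : ℝ) • EuclideanSpace.single 1 (1:ℝ) + x : Pl) 1 ∈ _
      rw [this]; exact hb
  · rintro ⟨w, hw2⟩ ⟨h0, h1⟩
    obtain ⟨a', b', e0, e1⟩ := mem_unitLattice.1 hw2
    change (w + x) 0 ∈ _ at h0
    change (w + x) 1 ∈ _ at h1
    have := ha' a' (by simpa [e0, add_comm] using h0)
    have := hb' b' (by simpa [e1, add_comm] using h1)
    subst a' b'
    apply Subtype.ext
    ext i
    fin_cases i
    · simpa using e0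
    · simpa using e1

lemma boxc_fund (c0 c1 : ℝ) : IsAddFundamentalDomain latGrp (boxc c0 c1) (volume : Measure Pl) :=
  IsAddFundamentalDomain.mk' (boxc_measurable c0 c1).nullMeasurableSet (boxc_cover c0 c1)

lemma fund_integral {h : Pl → ℝ} (hh : Periodic2 h) (c0 c1 : ℝ) :
    ∫ x in fund, h x = ∫ x in boxc c0 c1, h x := by
  have : fund = boxc 0 0 := by simp [fund, boxc]
  rw [this]
  haveI : Countable latGrp := unitLattice_countable.to_subtype
  refine (boxc_fund 0 0).setIntegral_eq (boxc_fund c0 c1) ?_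
  rintro ⟨w, hw⟩ x
  change h (w + x) = h x
  rw [add_comm]; exact hh x w hw

lemma Z_iff (V : VortexData) (x : Pl) : x ∈ V.Z ↔
    ∃ j : Fin V.d₁ ⊕ Fin V.d₂, ∃ v ∈ unitLattice, x = Sum.elim V.p₁ V.p₂ j + v := by
  constructor
  · rintro (⟨j, v, hv, rfl⟩ | ⟨j, v, hv, rfl⟩)
    · exact ⟨Sum.inl j, v, hv, rfl⟩
    · exact ⟨Sum.inr j, v, hv, rfl⟩
  · rintro ⟨j | j, v, hv, rfl⟩
    · exact Or.inl ⟨j, v, hv, rfl⟩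
    · exact Or.inr ⟨j, v, hv, rfl⟩

lemma Z_add (V : VortexData) {x w : Pl} (hx : x ∈ V.Z) (hw : w ∈ unitLattice) : x + w ∈ V.Z := by
  obtain ⟨j, v, hv, rfl⟩ := (Z_iff V x).1 hx
  exact (Z_iff V _).2 ⟨j, v + w, latGrp.add_mem hv hw, add_assoc _ _ _⟩

lemma corner (V : VortexData) (i : Fin 2) : ∃ c : ℝ, ∀ z ∈ V.Z, z i ≠ c ∧ z i ≠ c + 1 := by
  have hc : ((fun z : Pl => z i) '' V.Z ∪ (fun z : Pl => z i - 1) '' V.Z).Countable :=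
    ((Z_countable V).image _).union ((Z_countable V).image _)
  obtain ⟨c, hc⟩ : ∃ c, c ∉ ((fun z : Pl => z i) '' V.Z ∪ (fun z : Pl => z i - 1) '' V.Z) := by
    by_contra! h
    exact not_countable_univ (α := ℝ) (hc.mono (fun x _ => h x))
  refine ⟨c, fun z hz => ⟨fun h => hc (Or.inl ⟨z, hz, h⟩), fun h => hc (Or.inr ⟨z, hz, ?_⟩)⟩⟩
  simp [h]

lemma part_two {V : VortexData} {τ : ℝ} {ε : ℕ → ℝ} {u : ℕ → Pl → ℝ}
    (hτ : 0 < τ) (hε : ∀ n, 0 < ε n) (hε0 : Tendsto ε atTop (nhds 0))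
    (hu : ∀ n, IsSolution V τ (ε n) (u n))
    (htop : ∀ K : Set Pl, IsCompact K → K ⊆ (V.Z)ᶜ →
        TendstoUniformlyOn u (fun _ => (0:ℝ)) atTop K)
    {φ : Pl → ℝ} (hφ : Continuous φ) (hφp : Periodic2 φ) :
    Tendsto
        (fun k => ∫ x in fund,
          ((ε k) ^ 2)⁻¹ * (1 - exp (u k x)) ^ 2 / (τ + exp (u k x)) ^ 2 * φ x)
        atTop
        (nhds (4 * (τ + 1) * π *
          ((∑ j, (V.m₁ j) ^ 2 * φ (V.p₁ j)) + ∑ j, (V.m₂ j) ^ 2 * φ (V.p₂ j)))) := by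
  classical
  obtain ⟨c0, hc0⟩ := corner V 0
  obtain ⟨c1, hc1⟩ := corner V 1
  set P : Fin V.d₁ ⊕ Fin V.d₂ → Pl := Sum.elim V.p₁ V.p₂ with hP
  set a : Fin V.d₁ ⊕ Fin V.d₂ → ℝ := Sum.elim V.m₁ (fun j => -(V.m₂ j)) with ha
  have hex : ∀ j, ∃ w ∈ unitLattice, P j + w ∈ boxc c0 c1 := by
    intro j
    obtain ⟨⟨w, hw⟩, h, _⟩ := boxc_cover c0 c1 (P j)
    refine ⟨w, hw, ?_⟩
    rw [add_comm]; exact h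
  choose w hw hwD using hex
  set q : Fin V.d₁ ⊕ Fin V.d₂ → Pl := fun j => P j + w j with hq
  have hqZ : ∀ j, q j ∈ V.Z := fun j => (Z_iff V _).2 ⟨j, w j, hw j, rfl⟩
  have hinj : Function.Injective q := by
    intro i j hij
    by_contra hne
    refine V.distinct i j hne (w j - w i) (latGrp.sub_mem (hw j) (hw i)) ?_
    change P i = P j + (w j - w i)
    change P i + w i = P j + w j at hij
    rw [← add_sub_assoc, ← hij, add_sub_cancel_right]
  -- the open box
  set O : Set Pl := {x | x 0 ∈ Ioo c0 (c0 + 1) ∧ x 1 ∈ Ioo c1 (c1 + 1)} with hOdef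
  have hOo : IsOpen O := by
    have h0 : Continuous (fun x : Pl => x 0) := by fun_prop
    have h1 : Continuous (fun x : Pl => x 1) := by fun_prop
    exact (isOpen_Ioo.preimage h0).inter (isOpen_Ioo.preimage h1)
  have hOD : O ⊆ boxc c0 c1 := fun x hx => ⟨Ioo_subset_Ico_self hx.1, Ioo_subset_Ico_self hx.2⟩
  set Box : Set Pl := {x | x 0 ∈ Icc c0 (c0 + 1) ∧ x 1 ∈ Icc c1 (c1 + 1)} with hBdef
  have hDB : boxc c0 c1 ⊆ Box := fun x hx => ⟨Ico_subset_Icc_self hx.1, Ico_subset_Icc_self hx.2⟩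
  have hBox : IsCompact Box := by
    have h0 : Continuous (fun x : Pl => x 0) := by fun_prop
    have h1 : Continuous (fun x : Pl => x 1) := by fun_prop
    apply Metric.isCompact_of_isClosed_isBounded
    · exact (isClosed_Icc.preimage h0).inter (isClosed_Icc.preimage h1)
    · rw [isBounded_iff_forall_norm_le]
      refine ⟨(|c0| + 1) + (|c1| + 1), fun x hx => ?_⟩
      have n0 : |x 0| ≤ |c0| + 1 := by
        have := hx.1.1; have := hx.1.2; rw [abs_le]
        constructor <;> linarith [le_abs_self c0, neg_abs_le c0]
      have n1 : |x 1| ≤ |c1| + 1 := by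
        have := hx.2.1; have := hx.2.2; rw [abs_le]
        constructor <;> linarith [le_abs_self c1, neg_abs_le c1]
      rw [EuclideanSpace.norm_eq, Fin.sum_univ_two]
      apply Real.sqrt_le_iff.2
      simp only [Real.norm_eq_abs]
      constructor
      · positivity
      · nlinarith [abs_nonneg (x 0), abs_nonneg (x 1), abs_nonneg c0, abs_nonneg c1]
  have hZO : ∀ z ∈ V.Z, z ∈ Box → z ∈ O := fun z hz hb =>
    ⟨⟨lt_of_le_of_ne hb.1.1 (hc0 z hz).1.symm, lt_of_le_of_ne hb.1.2 (hc0 z hz).2⟩,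
     ⟨lt_of_le_of_ne hb.2.1 (hc1 z hz).1.symm, lt_of_le_of_ne hb.2.2 (hc1 z hz).2⟩⟩
  have hqO : ∀ j, q j ∈ O := fun j => hZO _ (hqZ j) (hDB (hwD j))
  have hZq : ∀ z ∈ V.Z, z ∈ Box → ∃ j, z = q j := by
    intro z hz hb
    have hzD := hOD (hZO z hz hb)
    obtain ⟨j, v, hv, rfl⟩ := (Z_iff V z).1 hz
    refine ⟨j, ?_⟩
    have := (boxc_cover c0 c1 (P j)).unique (y₁ := ⟨v, hv⟩) (y₂ := ⟨w j, hw j⟩)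
      (by change v + P j ∈ _; rw [add_comm]; exact hzD)
      (by change w j + P j ∈ _; rw [add_comm]; exact hwD j)
    have h2 : v = w j := congrArg Subtype.val this
    rw [h2]
  have hsing : ∀ j n, LogSing (u n) (q j) (a j) := by
    rintro (j | j) n
    · exact ((hu n).sing₁ j).translate (hu n).periodic (hw _)
    · exact ((hu n).sing₂ j).translate (hu n).periodic (hw _)
  have main := assemble (q := q) (D := boxc c0 c1) (Box := Box) (ε := ε)
    (g := fun k x => ((ε k) ^ 2)⁻¹ * Gf τ (u k x)) (A := fun j => 4 * (τ + 1) * π * (a j) ^ 2) (φ := φ)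
    hinj (boxc_measurable c0 c1)
    (fun j => mem_of_superset (hOo.mem_nhds (hqO j)) hOD) hDB hBox hε0
    (fun k x => mul_nonneg (by positivity) (Gf_nonneg τ _))
    (fun k => (Gsol_measurable hτ (hu k)).const_mul _)
    (fun k => ⟨|((ε k) ^ 2)⁻¹| * (1 + 1 / τ) ^ 2, fun x => by
      rw [abs_mul]; exact mul_le_mul_of_nonneg_left (Gf_bdd hτ _) (abs_nonneg _)⟩)
    (by
      have ev : ∀ᶠ r in 𝓝[>] (0:ℝ), ∀ j, closedBall (q j) r ⊆ O ∩ ⋂ i, {x | i ≠ j → x ≠ q i} := by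
        rw [eventually_all]
        intro j
        refine Filter.Eventually.filter_mono nhdsWithin_le_nhds (eventually_closedBall_subset ?_)
        refine inter_mem (hOo.mem_nhds (hqO j)) ?_
        rw [iInter_mem]
        intro i
        by_cases hij : i = j
        · simp [hij]
        · have : q j ≠ q i := fun h => hij (hinj h).symm
          filter_upwards [isOpen_ne.mem_nhds this] with x hx _
          exact hx
      obtain ⟨r, h, hr⟩ := (ev.and self_mem_nhdsWithin).exists
      replace hr : 0 < r := hr
      refine ⟨r ^ 2 / 2, by positivity, fun ρ hρ hρ0 j => ?_⟩
      refine local_limit hτ hε hε0 hu htop (hsing j) hρ ?_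
      intro x hx hd hxZ
      rw [dsq_eq, ← dist_eq_norm] at hd
      have hxr : dist x (q j) ≤ r := by
        have : dist x (q j) ^ 2 ≤ r ^ 2 := by linarith
        exact (sq_le_sq₀ dist_nonneg hr.le).1 this
      obtain ⟨hxO, hxi⟩ := h j (mem_closedBall.2 hxr)
      obtain ⟨i, rfl⟩ := hZq x hxZ (hDB (hOD hxO))
      exact mem_iInter.1 hxi i (fun hij => hx (by rw [hij])) rfl)
    (fun K hK hKB hqK => by
      obtain ⟨C, _, hC⟩ := density_negl hτ hε hε0 hu htop hK (fun x hx hxZ => by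
        obtain ⟨j, rfl⟩ := hZq x hxZ (hKB hx)
        exact hqK j hx)
      exact ⟨C, hC⟩)
    hφ
  have hsum : (∑ j, 4 * (τ + 1) * π * (a j) ^ 2 * φ (q j)) = 4 * (τ + 1) * π *
          ((∑ j, (V.m₁ j) ^ 2 * φ (V.p₁ j)) + ∑ j, (V.m₂ j) ^ 2 * φ (V.p₂ j)) := by
    have hφq : ∀ j, φ (q j) = φ (P j) := fun j => hφp _ _ (hw j)
    simp only [hφq, Fintype.sum_sum_type, hP, ha, Sum.elim_inl, Sum.elim_inr, neg_sq, mul_add,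
      Finset.mul_sum, mul_assoc]
  rw [← hsum]
  refine main.congr (fun k => ?_)
  have hper : Periodic2 (fun x => ((ε k) ^ 2)⁻¹ * (1 - exp (u k x)) ^ 2 / (τ + exp (u k x)) ^ 2 * φ x) := by
    intro x v hv
    simp only [(hu k).periodic x v hv, hφp x v hv]
  rw [fund_integral hper c0 c1]
  simp only [Gf, mul_div_assoc]

/-- **Lemma 5.1.** Let `u_ε` be a sequence of topological solutions of
`(E_ε)` (i.e. `u_ε → 0` uniformly on compact subsets of `Ω∖Z`). Then (i) on every compact
`K ⊆ Ω∖Z`, for all `m, n ≥ 1`, `sup_K Σ_{|α| ≤ m} |D^α u_ε| ≤ C(K,m,n) ε^n` for small `ε`;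
and (ii) `ε⁻²(1−e^{u_ε})²/(τ+e^{u_ε})² dx ⇀ 4(τ+1)π Σ_{i,j} m_{j,i}² δ_{p_{j,i}}` weakly
in the sense of measures on `Ω` (tested against continuous functions on the torus). -/
theorem topological_decay_and_concentration
    (V : VortexData) (τ : ℝ) (hτ : 0 < τ)
    (ε : ℕ → ℝ) (hε : ∀ n, 0 < ε n) (hε0 : Tendsto ε atTop (nhds 0))
    (u : ℕ → Pl → ℝ) (hu : ∀ n, IsSolution V τ (ε n) (u n))
    (htop : ∀ K : Set Pl, IsCompact K → K ⊆ (V.Z)ᶜ →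
        TendstoUniformlyOn u (fun _ => (0:ℝ)) atTop K) :
    (∀ K : Set Pl, IsCompact K → K ⊆ (V.Z)ᶜ → ∀ m n : ℕ, 1 ≤ m → 1 ≤ n →
      ∃ C > 0, ∀ᶠ k in atTop, ∀ x ∈ K,
        (∑ i ∈ Finset.range (m + 1), ‖iteratedFDeriv ℝ i (u k) x‖) ≤ C * (ε k) ^ n) ∧
    (∀ φ : Pl → ℝ, Continuous φ → Periodic2 φ →
      Tendsto
        (fun k => ∫ x in fund,
          ((ε k) ^ 2)⁻¹ * (1 - exp (u k x)) ^ 2 / (τ + exp (u k x)) ^ 2 * φ x)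
        atTop
        (nhds (4 * (τ + 1) * π *
          ((∑ j, (V.m₁ j) ^ 2 * φ (V.p₁ j)) + ∑ j, (V.m₂ j) ^ 2 * φ (V.p₂ j))))) := by
  exact ⟨fun K hK hKU m n _ _ => part_one hτ hε hε0 hu htop K hK hKU m n,
    fun φ hφ hφp => part_two hτ hε hε0 hu htop hφ hφp⟩
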